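/- arXiv:2203.14226 — 5 statements merged into one kernel-verified Lean document; each statement's English description precedes it below -/
import Mathlib

section
/- Let n ≥ 3 and let f ∈ ℂ[x, λ₁, …, λ_{n-1}] be a polynomial that is skew-symmetric in the variables λ₁, …, λ_{n-1} and satisfies the identity f(−λ₁−⋯−λ_n, λ₁, …, λ_{n-1}) · f(x, λ₁+⋯+λ_n, λ_{n+1}, …, λ_{2n-2}) = Σ_{i=1}^{n} (−1)^{n−i} f(x + Σ_{j≠i, j≤n} λ_j, λ_i, λ_{n+1}, …, λ_{2n-2}) · f(x, λ₁, …, λ̂ᵢ, …, λ_n) for all values of the variables. Then f = 0. -/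
noncomputable section

/-- Evaluation of a polynomial in the variables `x` (the `none` variable, playing the role
of `∂`) and `λ₁, …, λ_m` (the `some i` variables). -/
def ev {m : ℕ} (f : MvPolynomial (Option (Fin m)) ℂ) (x : ℂ) (l : Fin m → ℂ) : ℂ :=
  MvPolynomial.eval (fun v => v.elim x l) f

theorem ev_eq_eval_map {m : ℕ} (f : MvPolynomial (Option (Fin m)) ℂ) (x : ℂ) (l : Fin m → ℂ) :
    ev f x l =
      ((MvPolynomial.optionEquivLeft ℂ (Fin m) f).map (MvPolynomial.eval l)).eval x :=
  MvPolynomial.optionEquivLeft_elim_eval ℂ (Fin m) l x f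

/-- Substituting univariate polynomials for all variables yields a univariate polynomial. -/
theorem exists_polynomial_eval_eq {σ : Type*} (f : MvPolynomial σ ℂ) (w : σ → Polynomial ℂ) :
    ∃ P : Polynomial ℂ, ∀ t, P.eval t = MvPolynomial.eval (fun v => (w v).eval t) f := by
  refine ⟨MvPolynomial.aeval w f, fun t => ?_⟩
  induction f using MvPolynomial.induction_on with
  | C a => simp
  | add p q hp hq => simp [hp, hq]
  | mul_X p i hp => simp [hp]

theorem exists_polynomial_eval_eq_ev {m : ℕ} (f : MvPolynomial (Option (Fin m)) ℂ)
    (p : Polynomial ℂ) (l : Fin m → ℂ) (i : Fin m) (q : Polynomial ℂ) :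
    ∃ P : Polynomial ℂ, ∀ t, P.eval t = ev f (p.eval t) (Function.update l i (q.eval t)) := by
  obtain ⟨P, hP⟩ := exists_polynomial_eval_eq f
    (fun v => v.elim p (Function.update (fun j => Polynomial.C (l j)) i q))
  refine ⟨P, fun t => (hP t).trans ?_⟩
  unfold ev
  congr 2
  funext v
  cases v with
  | none => rfl
  | some j =>
    by_cases h : j = i
    · subst h; simp
    · simp [h]

theorem exists_ne_eval_update_ne_zero {m : ℕ} (c : MvPolynomial (Fin m) ℂ) (l : Fin m → ℂ)
    (i : Fin m) (h : MvPolynomial.eval l c ≠ 0) :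
    ∃ b, b ≠ l i ∧ MvPolynomial.eval (Function.update l i b) c ≠ 0 := by
  obtain ⟨P, hP⟩ := exists_polynomial_eval_eq c
    (Function.update (fun j => Polynomial.C (l j)) i Polynomial.X)
  have hP' : ∀ t, P.eval t = MvPolynomial.eval (Function.update l i t) c := by
    intro t
    rw [hP]
    congr 2
    funext j
    by_cases h : j = i
    · subst h; simp
    · simp [h]
  have hP0 : P ≠ 0 := by
    rintro rfl
    apply h
    simpa using (hP' (l i)).symm
  obtain ⟨b, hb⟩ := Infinite.exists_notMem_finset (insert (l i) P.roots.toFinset)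
  simp only [Finset.mem_insert, Multiset.mem_toFinset, not_or] at hb
  refine ⟨b, hb.1, fun h0 => hb.2 ?_⟩
  rw [Polynomial.mem_roots hP0, Polynomial.IsRoot, hP', h0]

theorem taylor_coeff_of_natDegree_le {p : Polynomial ℂ} {k : ℕ} (hp : p.natDegree ≤ k + 1)
    (u : ℂ) :
    (Polynomial.taylor u p).coeff k = p.coeff k + (k + 1) * u * p.coeff (k + 1) := by
  have hd : (Polynomial.hasseDeriv k p).natDegree < 2 := by
    have := Polynomial.natDegree_hasseDeriv_le p k
    omega
  rw [Polynomial.taylor_coeff, Polynomial.eval_eq_sum_range' hd]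
  simp only [Finset.sum_range_succ, Finset.sum_range_zero, Polynomial.hasseDeriv_coeff]
  rw [show 1 + k = k + 1 by ring]
  simp
  ring

theorem coeff_mul_of_natDegree_le_succ {p q : Polynomial ℂ} {k : ℕ}
    (hp : p.natDegree ≤ k + 1) (hq : q.natDegree ≤ k + 1) :
    (p * q).coeff (2 * k + 1) = p.coeff (k + 1) * q.coeff k + p.coeff k * q.coeff (k + 1) := by
  rw [Polynomial.coeff_mul]
  rw [← Finset.sum_subset (s₁ := {(k + 1, k), (k, k + 1)})]
  · rw [Finset.sum_pair (by simp)]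
  · intro x hx
    simp only [Finset.mem_insert, Finset.mem_singleton] at hx
    rw [Finset.HasAntidiagonal.mem_antidiagonal]
    rcases hx with rfl | rfl <;> simp only <;> ring
  · rintro ⟨a, b⟩ hx hx'
    simp only [Finset.HasAntidiagonal.mem_antidiagonal, Finset.mem_insert, Finset.mem_singleton,
      Prod.mk.injEq]
      at hx hx'
    rcases lt_or_ge (k + 1) a with h | h
    · rw [Polynomial.coeff_eq_zero_of_natDegree_lt (hp.trans_lt h), zero_mul]
    · rw [Polynomial.coeff_eq_zero_of_natDegree_lt (p := q) (hq.trans_lt (by omega)), mul_zero]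

/-- The coefficient of degree `2 N - 1` in `q(x + u) p(x) - p(x + v) q(x)` for `p`, `q` of degree
at most `N = k + 1`. -/
theorem coeff_taylor_mul_sub {p q : Polynomial ℂ} {k : ℕ}
    (hp : p.natDegree ≤ k + 1) (hq : q.natDegree ≤ k + 1) (u v : ℂ) :
    (Polynomial.taylor u q * p - Polynomial.taylor v p * q).coeff (2 * k + 1) =
      (k + 1) * (u - v) * p.coeff (k + 1) * q.coeff (k + 1) := by
  have top : ∀ {r : Polynomial ℂ}, r.natDegree ≤ k + 1 → ∀ w,
      (Polynomial.taylor w r).coeff (k + 1) = r.coeff (k + 1) := by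
    intro r hr w
    have hr' : r.natDegree ≤ (k + 1) + 1 := by omega
    rw [taylor_coeff_of_natDegree_le hr',
      Polynomial.coeff_eq_zero_of_natDegree_lt (n := k + 1 + 1) (by omega)]
    ring
  rw [Polynomial.coeff_sub,
    coeff_mul_of_natDegree_le_succ (by rwa [Polynomial.natDegree_taylor]) hp,
    coeff_mul_of_natDegree_le_succ (by rwa [Polynomial.natDegree_taylor]) hq,
    top hq, top hp, taylor_coeff_of_natDegree_le hq, taylor_coeff_of_natDegree_le hp]
  ring

section Skew

variable {m : ℕ} {f : MvPolynomial (Option (Fin m)) ℂ}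

theorem ev_eq_zero_of_eq
    (hskew : ∀ (x : ℂ) (l : Fin m → ℂ) (i j : Fin m), i ≠ j →
      ev f x (fun t => l (Equiv.swap i j t)) = - ev f x l)
    (x : ℂ) (l : Fin m → ℂ) {i j : Fin m} (hij : i ≠ j) (h : l i = l j) : ev f x l = 0 := by
  have hl : (fun t => l (Equiv.swap i j t)) = l := by
    funext t
    rw [Equiv.swap_apply_def]
    split_ifs with h1 h2
    · rw [h1, h]
    · rw [h2, h]
    · rfl
  have := hskew x l i j hij
  rw [hl] at this
  exact self_eq_neg.mp this

theorem ev_update_eq_zero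
    (hskew : ∀ (x : ℂ) (l : Fin m → ℂ) (i j : Fin m), i ≠ j →
      ev f x (fun t => l (Equiv.swap i j t)) = - ev f x l)
    (x : ℂ) (l : Fin m → ℂ) {i j : Fin m} (hij : j ≠ i) :
    ev f x (Function.update l i (l j)) = 0 :=
  ev_eq_zero_of_eq hskew x _ hij (by simp [hij])

end Skew

section Filippov

variable {k : ℕ} {f : MvPolynomial (Option (Fin (k + 2))) ℂ}

theorem ev_mul_ev_eq_zero
    (hskew : ∀ (x : ℂ) (l : Fin (k + 2) → ℂ) (i j : Fin (k + 2)), i ≠ j →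
      ev f x (fun t => l (Equiv.swap i j t)) = - ev f x l)
    (hid : ∀ (x : ℂ) (l : Fin (k + 2 + 1) → ℂ) (ν : Fin (k + 2) → ℂ),
      ev f (-(∑ j, l j)) (fun s => l s.castSucc) *
          ev f x (Function.update ν 0 (∑ j, l j))
        = ∑ i : Fin (k + 2 + 1), (-1 : ℂ) ^ (k + 2 - (i : ℕ)) *
            ev f (x + (∑ j, l j) - l i) (Function.update ν 0 (l i)) *
            ev f x (fun s => l (i.succAbove s)))
    (x : ℂ) (l : Fin (k + 2) → ℂ) {j : Fin (k + 2)} (hj : j ≠ 0) :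
    ev f (-(∑ i, l i + l j)) l * ev f x (Function.update l 0 (∑ i, l i + l j)) = 0 := by
  have h := hid x (Fin.snoc l (l j)) l
  have hS : ∑ i, (Fin.snoc l (l j) : Fin (k + 2 + 1) → ℂ) i = ∑ i, l i + l j := by
    rw [Fin.sum_univ_castSucc]; simp
  rw [hS] at h
  simp only [Fin.snoc_castSucc] at h
  rw [h]
  refine Finset.sum_eq_zero fun i _ => ?_
  induction i using Fin.lastCases with
  | last => simp [ev_update_eq_zero hskew _ l hj]
  | cast i =>
    by_cases hi : i = 0
    · subst hi
      obtain ⟨j', rfl⟩ := Fin.exists_succ_eq.mpr hj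
      rw [ev_eq_zero_of_eq hskew x _ (i := Fin.last (k + 1)) (j := j'.castSucc)
        (Fin.castSucc_lt_last j').ne' ?_, mul_zero]
      simp only [Fin.castSucc_zero, Fin.succAbove_zero, Fin.succ_last, Fin.snoc_last,
        Fin.succ_castSucc, Fin.snoc_castSucc]
    · rw [Fin.snoc_castSucc, ev_update_eq_zero hskew _ l hi]
      simp

theorem ev_neg_sum_add_eq_zero
    (hskew : ∀ (x : ℂ) (l : Fin (k + 2) → ℂ) (i j : Fin (k + 2)), i ≠ j →
      ev f x (fun t => l (Equiv.swap i j t)) = - ev f x l)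
    (hprod : ∀ (x : ℂ) (l : Fin (k + 2) → ℂ) (j : Fin (k + 2)), j ≠ 0 →
      ev f (-(∑ i, l i + l j)) l * ev f x (Function.update l 0 (∑ i, l i + l j)) = 0)
    (l : Fin (k + 2) → ℂ) (j : Fin (k + 2)) :
    ev f (-(∑ i, l i + l j)) l = 0 := by
  wlog hj : j ≠ 0 generalizing l j
  · push Not at hj
    subst hj
    have h := this (fun t => l (Equiv.swap 0 1 t)) 1 (by simp)
    rw [Equiv.sum_comp (Equiv.swap (0 : Fin (k + 2)) 1) l, hskew _ _ _ _ (by simp)] at h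
    simpa using h
  set d := ∑ i, l i - l 0 + l j with hd
  obtain ⟨U, hU⟩ := exists_polynomial_eval_eq_ev f (-(Polynomial.X + Polynomial.C d)) l 0
    Polynomial.X
  obtain ⟨V, hV⟩ := exists_polynomial_eval_eq_ev f (Polynomial.C (-(∑ i, l i + l j))) l 0
    (Polynomial.X + Polynomial.C d)
  simp only [Polynomial.eval_neg, Polynomial.eval_add, Polynomial.eval_X, Polynomial.eval_C]
    at hU hV
  have hUV : U * V = 0 := by
    refine Polynomial.funext fun t => ?_
    rw [Polynomial.eval_mul, hU, hV, Polynomial.eval_zero]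
    have h := hprod (-(∑ i, l i + l j)) (Function.update l 0 t) j hj
    have hsum : ∑ i, Function.update l 0 t i + l j = t + d := by
      rw [hd, Fin.sum_univ_succ, Fin.sum_univ_succ (f := l)]
      simp
      ring
    rwa [Function.update_idem, Function.update_of_ne hj, hsum] at h
  rcases mul_eq_zero.mp hUV with h | h
  · have := hU (l 0)
    rw [h, Polynomial.eval_zero, Function.update_eq_self] at this
    rw [this, hd]
    congr 1
    ring
  · have := hV (l 0 - d)
    rw [h, Polynomial.eval_zero, sub_add_cancel, Function.update_eq_self] at this
    exact this.symm

theorem ev_mul_ev_eq_sub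
    (hskew : ∀ (x : ℂ) (l : Fin (k + 2) → ℂ) (i j : Fin (k + 2)), i ≠ j →
      ev f x (fun t => l (Equiv.swap i j t)) = - ev f x l)
    (hid : ∀ (x : ℂ) (l : Fin (k + 2 + 1) → ℂ) (ν : Fin (k + 2) → ℂ),
      ev f (-(∑ j, l j)) (fun s => l s.castSucc) *
          ev f x (Function.update ν 0 (∑ j, l j))
        = ∑ i : Fin (k + 2 + 1), (-1 : ℂ) ^ (k + 2 - (i : ℕ)) *
            ev f (x + (∑ j, l j) - l i) (Function.update ν 0 (l i)) *
            ev f x (fun s => l (i.succAbove s)))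
    (l : Fin (k + 2) → ℂ) (b : ℂ) :
    ∃ C : ℂ, ∀ x, C * ev f x (Function.update l 0 (b + ∑ i, l i)) =
      ev f (x + ∑ i, l i) (Function.update l 0 b) * ev f x l -
        ev f (x + (b + ∑ i, l i - l 0)) l * ev f x (Function.update l 0 b) := by
  refine ⟨(-1) ^ k * ev f (-(b + ∑ i, l i))
    (fun s => (Fin.cons b l : Fin (k + 2 + 1) → ℂ) s.castSucc), fun x => ?_⟩
  have h := hid x (Fin.cons b l) l
  have hS : ∑ i, (Fin.cons b l : Fin (k + 2 + 1) → ℂ) i = b + ∑ i, l i := by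
    rw [Fin.sum_univ_succ]; simp
  rw [hS] at h
  generalize ∑ i, l i = T at h ⊢
  rw [mul_assoc, h, Fin.sum_univ_succ, Fin.sum_univ_succ, Finset.sum_eq_zero]
  · have h1 : (fun s => (Fin.cons b l : Fin (k + 2 + 1) → ℂ)
        ((Fin.succ 0 : Fin (k + 2 + 1)).succAbove s)) = Function.update l 0 b := by
      funext s
      induction s using Fin.cases with
      | zero => simp
      | succ s => simp
    rw [h1]
    have e1 : x + (b + T) - b = x + T := by ring
    have e2 : x + (b + T) - l 0 = x + (b + T - l 0) := by ring
    have hk : ((-1 : ℂ) ^ k) * (-1) ^ k = 1 := by rw [← mul_pow]; simp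
    have e3 : k + 2 - 1 = k + 1 := rfl
    simp [e1, e2, e3, pow_succ]
    linear_combination (ev f (x + T) (Function.update l 0 b) * ev f x l -
        ev f (x + (b + T - l 0)) l * ev f x (Function.update l 0 b)) * hk
  · intro i _
    rw [Fin.cons_succ, ev_update_eq_zero hskew _ l (Fin.succ_ne_zero i)]
    simp

theorem eq_zero_of_filippov
    (hskew : ∀ (x : ℂ) (l : Fin (k + 2) → ℂ) (i j : Fin (k + 2)), i ≠ j →
      ev f x (fun t => l (Equiv.swap i j t)) = - ev f x l)
    (hid : ∀ (x : ℂ) (l : Fin (k + 2 + 1) → ℂ) (ν : Fin (k + 2) → ℂ),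
      ev f (-(∑ j, l j)) (fun s => l s.castSucc) *
          ev f x (Function.update ν 0 (∑ j, l j))
        = ∑ i : Fin (k + 2 + 1), (-1 : ℂ) ^ (k + 2 - (i : ℕ)) *
            ev f (x + (∑ j, l j) - l i) (Function.update ν 0 (l i)) *
            ev f x (fun s => l (i.succAbove s))) :
    f = 0 := by
  have hroot := ev_neg_sum_add_eq_zero hskew
    (fun x l j hj => ev_mul_ev_eq_zero hskew hid x l hj)
  by_contra hf
  set F := MvPolynomial.optionEquivLeft ℂ (Fin (k + 2)) f with hF
  have hF0 : F.leadingCoeff ≠ 0 := by simpa [hF] using hf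
  obtain ⟨l, hl⟩ : ∃ l, MvPolynomial.eval l F.leadingCoeff ≠ 0 := by
    by_contra! h
    exact hF0 (MvPolynomial.funext fun l => by simpa using h l)
  obtain ⟨b, hbl, hb⟩ := exists_ne_eval_update_ne_zero _ l 0 hl
  set P : (Fin (k + 2) → ℂ) → Polynomial ℂ := fun l => F.map (MvPolynomial.eval l) with hP
  have hev : ∀ x l, ev f x l = (P l).eval x := fun x l => ev_eq_eval_map f x l
  have hdeg : ∀ l, (P l).natDegree ≤ F.natDegree := fun l => Polynomial.natDegree_map_le
  have hcoeff : ∀ l, (P l).coeff F.natDegree = MvPolynomial.eval l F.leadingCoeff := fun l => by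
    simp [hP]
  have hPl : P l ≠ 0 := by
    intro h
    apply hl
    rw [← hcoeff, h, Polynomial.coeff_zero]
  have hl01 : l 0 ≠ l 1 := by
    intro h
    refine hPl (Polynomial.funext fun x => ?_)
    rw [← hev, ev_eq_zero_of_eq hskew x l (by simp) h, Polynomial.eval_zero]
  have htwo : 2 ≤ (P l).natDegree := by
    have hsub : ({-(∑ i, l i + l 0), -(∑ i, l i + l 1)} : Finset ℂ).val ⊆ (P l).roots := by
      intro x hx
      rw [Polynomial.mem_roots hPl, Polynomial.IsRoot, ← hev]
      simp only [Finset.mem_val, Finset.mem_insert, Finset.mem_singleton] at hx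
      rcases hx with rfl | rfl <;> exact hroot l _
    have := Polynomial.card_le_degree_of_subset_roots hsub
    rwa [Finset.card_pair (by simpa using hl01)] at this
  obtain ⟨N, hN⟩ : ∃ N, F.natDegree = N + 1 := ⟨F.natDegree - 1, by have := hdeg l; omega⟩
  have hN1 : 1 ≤ N := by have := hdeg l; omega
  obtain ⟨C, hC⟩ := ev_mul_ev_eq_sub hskew hid l b
  have hpoly : Polynomial.C C * P (Function.update l 0 (b + ∑ i, l i)) =
      Polynomial.taylor (∑ i, l i) (P (Function.update l 0 b)) * P l -
        Polynomial.taylor (b + ∑ i, l i - l 0) (P l) * P (Function.update l 0 b) := by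
    refine Polynomial.funext fun x => ?_
    simpa [hev, Polynomial.taylor_eval] using hC x
  have h := congrArg (fun p => p.coeff (2 * N + 1)) hpoly
  rw [coeff_taylor_mul_sub (hN ▸ hdeg _) (hN ▸ hdeg _), Polynomial.coeff_C_mul,
    Polynomial.coeff_eq_zero_of_natDegree_lt ((hdeg _).trans_lt (by omega)), mul_zero, ← hN,
    hcoeff, hcoeff] at h
  have hne : (N + 1 : ℂ) * (∑ i, l i - (b + ∑ i, l i - l 0)) ≠ 0 := by
    refine mul_ne_zero (by exact_mod_cast N.succ_ne_zero) fun h => hbl ?_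
    linear_combination -h
  exact mul_ne_zero (mul_ne_zero hne hl) hb h.symm

end Filippov

/-- with `m = n - 1` (so `n = m + 1 ≥ 3`), a polynomial
`f ∈ ℂ[x, λ₁, …, λ_{n-1}]` which is skew-symmetric in the `λ` variables and satisfies the
Filippov-type identity
`f(−λ₁−⋯−λ_n, λ₁, …, λ_{n-1}) · f(x, λ₁+⋯+λ_n, λ_{n+1}, …, λ_{2n-2})
  = Σ_{i=1}^{n} (−1)^{n−i} f(x + Σ_{j≠i} λ_j, λ_i, λ_{n+1}, …, λ_{2n-2}) · f(x, λ₁, …, λ̂ᵢ, …, λ_n)`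
must vanish.  The values `λ_{n+1}, …, λ_{2n-2}` are the entries `ν 1, …, ν (m-1)` of an
arbitrary vector `ν` (the entry `ν 0` being overwritten). -/
theorem stmt0 (m : ℕ) (hm : 2 ≤ m) (f : MvPolynomial (Option (Fin m)) ℂ)
    (hskew : ∀ (x : ℂ) (l : Fin m → ℂ) (i j : Fin m), i ≠ j →
      ev f x (fun t => l (Equiv.swap i j t)) = - ev f x l)
    (hid : ∀ (x : ℂ) (l : Fin (m + 1) → ℂ) (ν : Fin m → ℂ),
      ev f (-(∑ j, l j)) (fun s => l s.castSucc) *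
          ev f x (Function.update ν ⟨0, by omega⟩ (∑ j, l j))
        = ∑ i : Fin (m + 1), (-1 : ℂ) ^ (m - (i : ℕ)) *
            ev f (x + (∑ j, l j) - l i) (Function.update ν ⟨0, by omega⟩ (l i)) *
            ev f x (fun s => l (i.succAbove s))) :
    f = 0 := by
  obtain ⟨k, rfl⟩ : ∃ k, m = k + 2 := ⟨m - 2, by omega⟩
  exact eq_zero_of_filippov hskew hid
end
end

section
/- Let 𝔤 be an n-Lie algebra. Define on Cur 𝔤 = ℂ[∂] ⊗ 𝔤 the conformal products by g¹_{(0)}⋯_{(0)}gⁿ = [g¹, …, gⁿ] and g¹_{(k₁)}⋯_{(k_{n-1})}gⁿ = 0 whenever k₁ + ⋯ + k_{n-1} > 0, extended by conformal sesquilinearity. Then Cur 𝔤 is an n-Lie conformal algebra. -/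
noncomputable section

open Finset

/-- The index `n - 2` (position of `λ_{n-1}`, the last conformal weight) in `Fin m`,
where `m = n - 1`. -/
def lastIdx (m : ℕ) [NeZero m] : Fin m :=
  ⟨m - 1, Nat.sub_lt (Nat.pos_of_ne_zero (NeZero.ne m)) Nat.one_pos⟩

/-- Divided power `z^(k) = z^k / k!`. -/
def dPow (z : ℂ) (k : ℕ) : ℂ := z ^ k / (k.factorial : ℂ)

variable {m : ℕ} [NeZero m] {R : Type*} [AddCommGroup R] [Module ℂ R]

/-- Evaluation of the `{λ₁,…,λ_{n-1}}`-bracket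
`[x¹ _{λ₁} ⋯ _{λ_{n-1}} x^n] = Σ_k λ₁^(k₁)⋯λ_{n-1}^(k_{n-1}) x¹_{(k₁)}⋯_{(k_{n-1})}x^n`
at complex values of the `λ`'s (here `m = n - 1`). -/
def pEval (prodl : (Fin m → ℕ) → MultilinearMap ℂ (fun _ : Fin (m + 1) => R) R)
    (lam : Fin m → ℂ) (x : Fin (m + 1) → R) : R :=
  ∑ᶠ k : Fin m → ℕ, (∏ s, dPow (lam s) (k s)) • prodl k x

/-- Evaluation of the bracket where the last conformal weight `λ_{n-1}` is replaced by the
operator `−∂ − c` (divided-power substitution), as needed for the conformal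
skew-symmetry in the last slot. -/
def pEvalOp (D : Module.End ℂ R)
    (prodl : (Fin m → ℕ) → MultilinearMap ℂ (fun _ : Fin (m + 1) => R) R)
    (lam : Fin m → ℂ) (c : ℂ) (x : Fin (m + 1) → R) : R :=
  ∑ᶠ k : Fin m → ℕ,
    (∏ s ∈ Finset.univ.erase (lastIdx m), dPow (lam s) (k s)) •
      (((k (lastIdx m)).factorial : ℂ)⁻¹ •
        ((-(D + c • (1 : Module.End ℂ R))) ^ (k (lastIdx m))) (prodl k x))

/-- An `n`-Lie conformal algebra with `n = m + 1`: a `ℂ[∂]`-module (a complex vector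
space `R` together with the action `D` of `∂`) with `n`-ary `k`-products
`x¹_{(k₁)}⋯_{(k_{n-1})}x^n` (multilinear over ℂ), satisfying, in terms of the associated
`λ`-brackets evaluated at complex points: local finiteness (C1), conformal
sesquilinearity (C2), skew-symmetry including the last-slot relation
`[x¹⋯x^{n-1}_{λ_{n-1}}x^n] = −[x¹⋯x^n_{−∂−λ₁−⋯−λ_{n-1}}x^{n-1}]` (C3), and the conformal
Filippov identity (C4). -/
structure NLieConfAlg (m : ℕ) [NeZero m] (R : Type*) [AddCommGroup R] [Module ℂ R] where
  D : Module.End ℂ R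
  prodl : (Fin m → ℕ) → MultilinearMap ℂ (fun _ : Fin (m + 1) => R) R
  locFin : ∀ x : Fin (m + 1) → R, ∃ N : ℕ, ∀ k : Fin m → ℕ, N ≤ ∑ s, k s → prodl k x = 0
  sesq : ∀ (lam : Fin m → ℂ) (x : Fin (m + 1) → R) (i : Fin m),
    pEval prodl lam (Function.update x i.castSucc (D (x i.castSucc)))
      = -(lam i) • pEval prodl lam x
  sesqLast : ∀ (lam : Fin m → ℂ) (x : Fin (m + 1) → R),
    pEval prodl lam (Function.update x (Fin.last m) (D (x (Fin.last m))))
      = D (pEval prodl lam x) + (∑ s, lam s) • pEval prodl lam x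
  skew : ∀ (lam : Fin m → ℂ) (x : Fin (m + 1) → R) (i j : Fin m), i ≠ j →
    pEval prodl (fun t => lam (Equiv.swap i j t))
        (fun t => x (Equiv.swap i.castSucc j.castSucc t))
      = - pEval prodl lam x
  skewLast : ∀ (lam : Fin m → ℂ) (x : Fin (m + 1) → R),
    pEval prodl lam x
      = - pEvalOp D prodl lam (∑ s, lam s)
          (fun t => x (Equiv.swap (Fin.castSucc (lastIdx m)) (Fin.last m) t))
  filippov : ∀ (lam : Fin (m + 1) → ℂ) (mus : Fin m → ℂ)
      (a : Fin (m + 1) → R) (b : Fin m → R),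
    ∑ i : Fin (m + 1), ((-1 : ℂ) ^ (m - (i : ℕ))) •
        pEval prodl (fun s => lam (i.succAbove s))
          (Fin.snoc (fun s => a (i.succAbove s))
            (pEval prodl (Function.update mus 0 (lam i)) (Fin.cons (a i) b)))
      = pEval prodl (Function.update mus 0 (∑ i, lam i))
          (Fin.cons (pEval prodl (fun s => lam s.castSucc) a) b)

section CurrentAlgebra

variable {n : ℕ} {g : Type*} [AddCommGroup g] [Module ℂ g]

/-- The action of `∂` on `Cur 𝔤`, as a shift of degrees. -/
def curD (g : Type*) [AddCommGroup g] [Module ℂ g] : Module.End ℂ (ℕ →₀ g) :=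
  Finsupp.lsum ℂ (fun s : ℕ => Finsupp.lsingle (s + 1))

lemma curD_single (s : ℕ) (a : g) :
    curD g (Finsupp.single s a) = Finsupp.single (s + 1) a := by
  simp [curD]

lemma curD_pow_single (s : ℕ) (a : g) :
    (curD g ^ s) (Finsupp.single 0 a) = Finsupp.single s a := by
  induction s with
  | zero => simp
  | succ s ih => rw [pow_succ', Module.End.mul_apply, ih, curD_single]

/-- Evaluation of a `𝔤`-valued polynomial in `∂` at a complex number. -/
def curEval (g : Type*) [AddCommGroup g] [Module ℂ g] (c : ℂ) : (ℕ →₀ g) →ₗ[ℂ] g :=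
  Finsupp.lsum ℂ (fun s : ℕ => c ^ s • LinearMap.id)

lemma curEval_single (c : ℂ) (s : ℕ) (a : g) :
    curEval g c (Finsupp.single s a) = c ^ s • a := by
  simp [curEval]

/-- The substitution `∂ ↦ ∂ + c` in a `𝔤`-valued polynomial. -/
def curShift (g : Type*) [AddCommGroup g] [Module ℂ g] (c : ℂ) : Module.End ℂ (ℕ →₀ g) :=
  Finsupp.lsum ℂ (fun s : ℕ => ((curD g + c • 1) ^ s) ∘ₗ Finsupp.lsingle 0)

lemma curShift_single (c : ℂ) (s : ℕ) (a : g) :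
    curShift g c (Finsupp.single s a) = ((curD g + c • 1) ^ s) (Finsupp.single 0 a) := by
  simp [curShift]

lemma curEval_curD (c : ℂ) (x : ℕ →₀ g) :
    curEval g c (curD g x) = c • curEval g c x := by
  suffices h : curEval g c ∘ₗ curD g = c • curEval g c from LinearMap.congr_fun h x
  ext s a
  simp [curEval_single, curD_single, pow_succ', mul_smul]

lemma curShift_curD (c : ℂ) (x : ℕ →₀ g) :
    curShift g c (curD g x) = curD g (curShift g c x) + c • curShift g c x := by
  suffices h : curShift g c ∘ₗ curD g = (curD g + c • 1) ∘ₗ curShift g c from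
    LinearMap.congr_fun h x
  refine Finsupp.lhom_ext fun s a => ?_
  simp only [LinearMap.comp_apply, curD_single, curShift_single, pow_succ']
  rfl

lemma curShift_pow_single (b c : ℂ) (s : ℕ) (a : g) :
    curShift g c (((curD g + b • 1) ^ s) (Finsupp.single 0 a)) =
      ((curD g + (c + b) • 1) ^ s) (Finsupp.single 0 a) := by
  induction s with
  | zero => simp [curShift_single]
  | succ s ih =>
    simp only [pow_succ', Module.End.mul_apply, ← ih]
    simp only [LinearMap.add_apply, LinearMap.smul_apply, Module.End.one_apply, map_add,
      map_smul, curShift_curD, add_smul]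
    abel

lemma curShift_curShift (b c : ℂ) (x : ℕ →₀ g) :
    curShift g c (curShift g b x) = curShift g (c + b) x := by
  suffices h : curShift g c ∘ₗ curShift g b = curShift g (c + b) from LinearMap.congr_fun h x
  refine Finsupp.lhom_ext fun s a => ?_
  simp only [LinearMap.comp_apply, curShift_single, curShift_pow_single]

lemma curEval_pow_single (b c : ℂ) (s : ℕ) (a : g) :
    curEval g c (((curD g + b • 1) ^ s) (Finsupp.single 0 a)) = (c + b) ^ s • a := by
  induction s with
  | zero => simp [curEval_single]
  | succ s ih =>
    simp only [pow_succ', Module.End.mul_apply, LinearMap.add_apply, LinearMap.smul_apply,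
      Module.End.one_apply, map_add, map_smul, curEval_curD, ih, add_smul, mul_smul]

lemma curEval_curShift (b c : ℂ) (x : ℕ →₀ g) :
    curEval g c (curShift g b x) = curEval g (c + b) x := by
  suffices h : curEval g c ∘ₗ curShift g b = curEval g (c + b) from LinearMap.congr_fun h x
  refine Finsupp.lhom_ext fun s a => ?_
  simp only [LinearMap.comp_apply, curShift_single, curEval_pow_single, curEval_single]

/-- A linear map `𝔤 → 𝔤` extends `ℂ[∂]`-linearly to currents. -/
abbrev curMap (f : g →ₗ[ℂ] g) : Module.End ℂ (ℕ →₀ g) := Finsupp.mapRange.linearMap f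

lemma curMap_curD (f : g →ₗ[ℂ] g) (x : ℕ →₀ g) :
    curMap f (curD g x) = curD g (curMap f x) := by
  suffices h : curMap f ∘ₗ curD g = curD g ∘ₗ curMap f from LinearMap.congr_fun h x
  refine Finsupp.lhom_ext fun s a => ?_
  simp [curD_single]

lemma curMap_aeval (f : g →ₗ[ℂ] g) (p : Polynomial ℂ) (x : ℕ →₀ g) :
    curMap f (Polynomial.aeval (curD g) p x) = Polynomial.aeval (curD g) p (curMap f x) := by
  have h : Commute (curMap f) (curD g) := LinearMap.ext (curMap_curD f)
  have h' : Commute (curMap f) (Polynomial.aeval (curD g) p) := by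
    induction p using Polynomial.induction_on' with
    | add p q hp hq => simpa using hp.add_right hq
    | monomial k c =>
      simpa [Polynomial.aeval_monomial] using
        (show Commute (curMap f) (algebraMap ℂ _ c) from
          (Algebra.commutes c (curMap f)).symm).mul_right (h.pow_right k)
  exact LinearMap.congr_fun h' x

lemma curShift_single_eq_aeval (c : ℂ) (s : ℕ) (a : g) :
    curShift g c (Finsupp.single s a) =
      Polynomial.aeval (curD g) ((Polynomial.X + Polynomial.C c) ^ s) (Finsupp.single 0 a) := by
  rw [curShift_single]
  simp [Algebra.algebraMap_eq_smul_one]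

lemma curMap_curShift (f : g →ₗ[ℂ] g) (c : ℂ) (x : ℕ →₀ g) :
    curMap f (curShift g c x) = curShift g c (curMap f x) := by
  suffices h : curMap f ∘ₗ curShift g c = curShift g c ∘ₗ curMap f from LinearMap.congr_fun h x
  refine Finsupp.lhom_ext fun s a => ?_
  rw [LinearMap.comp_apply, LinearMap.comp_apply, curShift_single_eq_aeval, curMap_aeval,
    Finsupp.mapRange.linearMap_apply, Finsupp.mapRange.linearMap_apply, Finsupp.mapRange_single,
    Finsupp.mapRange_single, curShift_single_eq_aeval]

lemma curEval_curMap (f : g →ₗ[ℂ] g) (c : ℂ) (x : ℕ →₀ g) :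
    curEval g c (curMap f x) = f (curEval g c x) := by
  suffices h : curEval g c ∘ₗ curMap f = f ∘ₗ curEval g c from LinearMap.congr_fun h x
  refine Finsupp.lhom_ext fun s a => ?_
  simp [curEval_single]

/-- The multilinear operation on `Cur 𝔤` given on generators by
`(∂^{d₁}a₁, …, ∂^{dₙ}aₙ) ↦ c(d)(∂) [a₁, …, aₙ]`. -/
def curProd (br : AlternatingMap ℂ g g (Fin (n + 1)))
    (c : (Fin (n + 1) → ℕ) → Polynomial ℂ) :
    MultilinearMap ℂ (fun _ : Fin (n + 1) => ℕ →₀ g) (ℕ →₀ g) :=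
  have hfin (x : Fin (n + 1) → ℕ →₀ g) :
      (Function.support fun d : Fin (n + 1) → ℕ =>
        Polynomial.aeval (curD g) (c d) (Finsupp.single 0 (br fun i => x i (d i)))).Finite := by
    refine (Fintype.piFinset fun i => (x i).support).finite_toSet.subset fun d hd => ?_
    rw [Finset.mem_coe, Fintype.mem_piFinset]
    intro i
    rw [Finsupp.mem_support_iff]
    intro h0
    exact hd (by simp [br.map_coord_zero (m := fun i => x i (d i)) i h0])
  have hupd (x : Fin (n + 1) → ℕ →₀ g) [DecidableEq (Fin (n + 1))] (i : Fin (n + 1)) (u : ℕ →₀ g)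
      (d : Fin (n + 1) → ℕ) : (fun j => Function.update x i u j (d j)) =
        Function.update (fun j => x j (d j)) i (u (d i)) := by
    ext j
    rcases eq_or_ne j i with rfl | h <;> simp [*]
  { toFun := fun x => ∑ᶠ d : Fin (n + 1) → ℕ,
      Polynomial.aeval (curD g) (c d) (Finsupp.single 0 (br fun i => x i (d i)))
    map_update_add' := fun x i u v => by
      rw [← finsum_add_distrib (hfin _) (hfin _)]
      simp only [hupd, Finsupp.add_apply, br.map_update_add, Finsupp.single_add, map_add]
    map_update_smul' := fun x i r u => by
      rw [smul_finsum' _ (hfin _)]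
      simp only [hupd, Finsupp.smul_apply, br.map_update_smul, ← Finsupp.smul_single, map_smul] }

lemma curProd_apply (br : AlternatingMap ℂ g g (Fin (n + 1)))
    (c : (Fin (n + 1) → ℕ) → Polynomial ℂ) (x : Fin (n + 1) → ℕ →₀ g) :
    curProd br c x = ∑ᶠ d : Fin (n + 1) → ℕ,
      Polynomial.aeval (curD g) (c d) (Finsupp.single 0 (br fun i => x i (d i))) := rfl

lemma curProd_eq_sum (br : AlternatingMap ℂ g g (Fin (n + 1)))
    (c : (Fin (n + 1) → ℕ) → Polynomial ℂ) (x : Fin (n + 1) → ℕ →₀ g) :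
    curProd br c x = ∑ d ∈ Fintype.piFinset fun i => (x i).support,
      Polynomial.aeval (curD g) (c d) (Finsupp.single 0 (br fun i => x i (d i))) := by
  refine finsum_eq_sum_of_support_subset _ fun d hd => ?_
  rw [Finset.mem_coe, Fintype.mem_piFinset]
  intro i
  rw [Finsupp.mem_support_iff]
  intro h0
  exact hd (by simp [br.map_coord_zero (m := fun i => x i (d i)) i h0])

lemma curProd_single (br : AlternatingMap ℂ g g (Fin (n + 1)))
    (c : (Fin (n + 1) → ℕ) → Polynomial ℂ) (d : Fin (n + 1) → ℕ) (a : Fin (n + 1) → g) :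
    curProd br c (fun i => Finsupp.single (d i) (a i)) =
      Polynomial.aeval (curD g) (c d) (Finsupp.single 0 (br a)) := by
  rw [curProd_apply, finsum_eq_single _ d]
  · simp
  · intro e he
    obtain ⟨i, hi⟩ := Function.ne_iff.mp he
    rw [br.map_coord_zero (m := fun i => Finsupp.single (d i) (a i) (e i)) i
      (Finsupp.single_eq_of_ne hi)]
    simp

lemma curProd_comp_perm (br : AlternatingMap ℂ g g (Fin (n + 1)))
    (c : (Fin (n + 1) → ℕ) → Polynomial ℂ) (x : Fin (n + 1) → ℕ →₀ g) {i j : Fin (n + 1)}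
    (hij : i ≠ j) :
    curProd br c (fun t => x (Equiv.swap i j t)) =
      - curProd br (fun d => c fun t => d (Equiv.swap i j t)) x := by
  simp only [curProd_apply, ← finsum_neg_distrib]
  rw [← finsum_comp_equiv (Equiv.arrowCongr (Equiv.swap i j) (Equiv.refl ℕ))]
  refine finsum_congr fun d => ?_
  have := br.map_swap (fun t => x t (d t)) hij
  simp only [Function.comp_def] at this
  rw [show (Equiv.arrowCongr (Equiv.swap i j) (Equiv.refl ℕ)) d =
    fun t => d (Equiv.swap i j t) from rfl]
  simpa using congrArg (fun y => Polynomial.aeval (curD g) (c fun t => d (Equiv.swap i j t))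
    (Finsupp.single 0 y)) this

lemma multilinearMap_ext_single {f₁ f₂ : MultilinearMap ℂ (fun _ : Fin (n + 1) => ℕ →₀ g) g}
    (h : ∀ (d : Fin (n + 1) → ℕ) (a : Fin (n + 1) → g),
      f₁ (fun i => Finsupp.single (d i) (a i)) = f₂ (fun i => Finsupp.single (d i) (a i))) :
    f₁ = f₂ := by
  ext x
  have hx : x = fun i => ∑ d ∈ (x i).support, Finsupp.single d (x i d) :=
    funext fun i => (Finsupp.sum_single (x i)).symm
  rw [hx, MultilinearMap.map_sum_finset, MultilinearMap.map_sum_finset]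
  exact Finset.sum_congr rfl fun d _ => h d _

/-- The bracket as a linear map of its last argument. -/
def bracketLast (br : AlternatingMap ℂ g g (Fin (n + 1))) (v : Fin n → g) : g →ₗ[ℂ] g :=
  br.toMultilinearMap.toLinearMap (Fin.snoc v 0) (Fin.last n)

lemma bracketLast_apply (br : AlternatingMap ℂ g g (Fin (n + 1))) (v : Fin n → g) (w : g) :
    bracketLast br v w = br (Fin.snoc v w) := by
  simp [bracketLast, Fin.update_snoc_last]

open Polynomial in
lemma curProd_eq_curMap (br : AlternatingMap ℂ g g (Fin (n + 1))) (lam : Fin n → ℂ) (c : ℂ)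
    (x : Fin (n + 1) → ℕ →₀ g) :
    curProd br (fun d => (∏ s, (-C (lam s)) ^ d s.castSucc) * (X + C c) ^ d (Fin.last n)) x =
      curMap (bracketLast br fun s => curEval g (-lam s) (x s.castSucc))
        (curShift g c (x (Fin.last n))) := by
  ext r
  let F : Fin (n + 1) → (ℕ →₀ g) →ₗ[ℂ] g :=
    Fin.snoc (α := fun _ => (ℕ →₀ g) →ₗ[ℂ] g) (fun s => curEval g (-lam s))
      (Finsupp.lapply r ∘ₗ curShift g c)
  have hF (y : Fin (n + 1) → ℕ →₀ g) :
      (curMap (bracketLast br fun s => curEval g (-lam s) (y s.castSucc))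
        (curShift g c (y (Fin.last n)))) r = br.toMultilinearMap.compLinearMap F y := by
    simp only [Finsupp.mapRange.linearMap_apply, Finsupp.mapRange_apply, bracketLast_apply,
      MultilinearMap.compLinearMap_apply, AlternatingMap.coe_multilinearMap]
    congr 1
    ext i
    cases i using Fin.lastCases <;> simp [F]
  rw [hF]
  suffices h : (Finsupp.lapply r).compMultilinearMap (curProd br fun d =>
      (∏ s, (-C (lam s)) ^ d s.castSucc) * (X + C c) ^ d (Fin.last n)) =
        br.toMultilinearMap.compLinearMap F from congrArg (fun f => f x) h
  refine multilinearMap_ext_single fun d a => ?_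
  rw [← hF, curShift_single_eq_aeval, curMap_aeval]
  have hsnoc : br (Fin.snoc (fun s => curEval g (-lam s) (Finsupp.single (d s.castSucc)
      (a s.castSucc))) (a (Fin.last n))) = (∏ s, (-lam s) ^ d s.castSucc) • br a := by
    have := br.toMultilinearMap.map_smul_univ
      (Fin.snoc (α := fun _ => ℂ) (fun s => (-lam s) ^ d s.castSucc) 1) a
    simp only [Fin.prod_univ_castSucc, Fin.snoc_castSucc, Fin.snoc_last, mul_one,
      AlternatingMap.coe_multilinearMap] at this
    rw [← this]
    congr 1
    ext i
    cases i using Fin.lastCases <;> simp [curEval_single]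
  have hC : (∏ s, (-C (lam s)) ^ d s.castSucc : ℂ[X]) = C (∏ s, (-lam s) ^ d s.castSucc) := by
    simp [map_prod]
  simp only [LinearMap.compMultilinearMap_apply, curProd_single, Finsupp.lapply_apply,
    Finsupp.mapRange.linearMap_apply, Finsupp.mapRange_single, bracketLast_apply, hsnoc, hC,
    ← Finsupp.smul_single, map_smul, map_mul, aeval_C, Module.End.mul_apply,
    Module.algebraMap_end_apply, Finsupp.smul_apply]

open MvPolynomial in
/-- The polynomial `∏ₛ (-λₛ)^{dₛ} · (∂ + ∑ₛ λₛ)^{dₙ}` in the `λ`'s with coefficients in `ℂ[∂]`. -/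
def curPoly (d : Fin (n + 1) → ℕ) : MvPolynomial (Fin n) (Polynomial ℂ) :=
  (∏ s, (-X s) ^ d s.castSucc) * (C Polynomial.X + ∑ s, X s) ^ d (Fin.last n)

lemma eval_curPoly (w : Fin n → Polynomial ℂ) (d : Fin (n + 1) → ℕ) :
    MvPolynomial.eval w (curPoly d) =
      (∏ s, (-w s) ^ d s.castSucc) * (Polynomial.X + ∑ s, w s) ^ d (Fin.last n) := by
  simp [curPoly, map_prod]

/-- The coefficient in `ℂ[∂]` of `∏ₛ λₛ^{kₛ} / kₛ!` in `curPoly d`. -/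
def curCoeff (k : Fin n → ℕ) (d : Fin (n + 1) → ℕ) : Polynomial ℂ :=
  Polynomial.C (∏ s, ((k s).factorial : ℂ)) *
    (curPoly d).coeff (Finsupp.equivFunOnFinite.symm k)

lemma mul_curCoeff (w : Fin n → Polynomial ℂ) (k : Fin n → ℕ) (d : Fin (n + 1) → ℕ) :
    (∏ s, Polynomial.C ((k s).factorial : ℂ)⁻¹ * w s ^ k s) * curCoeff k d =
      (curPoly d).coeff (Finsupp.equivFunOnFinite.symm k) * ∏ s, w s ^ k s := by
  have h : (∏ s, Polynomial.C ((k s).factorial : ℂ)⁻¹) *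
      Polynomial.C (∏ s, ((k s).factorial : ℂ)) = 1 := by
    rw [← map_prod, ← map_mul, ← Finset.prod_mul_distrib, Finset.prod_eq_one, map_one]
    intro s _
    exact inv_mul_cancel₀ (Nat.cast_ne_zero.mpr (Nat.factorial_ne_zero _))
  rw [curCoeff, Finset.prod_mul_distrib]
  generalize (curPoly d).coeff (Finsupp.equivFunOnFinite.symm k) = q
  generalize ∏ s, w s ^ k s = W at *
  linear_combination q * W * h

lemma eval_curPoly_eq_sum (w : Fin n → Polynomial ℂ) (d : Fin (n + 1) → ℕ)
    {S : Finset (Fin n →₀ ℕ)} (hS : (curPoly d).support ⊆ S) :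
    MvPolynomial.eval w (curPoly d) =
      ∑ k ∈ S, (curPoly d).coeff k * ∏ s, w s ^ k s := by
  rw [MvPolynomial.eval_eq']
  refine Finset.sum_subset hS fun k _ hk => ?_
  rw [MvPolynomial.notMem_support_iff.mp hk, zero_mul]

lemma aeval_curProd (br : AlternatingMap ℂ g g (Fin (n + 1))) (p : Polynomial ℂ)
    (c : (Fin (n + 1) → ℕ) → Polynomial ℂ) (x : Fin (n + 1) → ℕ →₀ g) :
    Polynomial.aeval (curD g) p (curProd br c x) = curProd br (fun d => p * c d) x := by
  simp only [curProd_eq_sum, map_sum, map_mul, Module.End.mul_apply]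

lemma finsum_curProd (br : AlternatingMap ℂ g g (Fin (n + 1))) (w : Fin n → Polynomial ℂ)
    (x : Fin (n + 1) → ℕ →₀ g) :
    ∑ᶠ k : Fin n → ℕ, Polynomial.aeval (curD g)
        (∏ s, Polynomial.C ((k s).factorial : ℂ)⁻¹ * w s ^ k s) (curProd br (curCoeff k) x) =
      curProd br (fun d => MvPolynomial.eval w (curPoly d)) x := by
  classical
  simp only [aeval_curProd, mul_curCoeff]
  rw [← finsum_comp_equiv (Finsupp.equivFunOnFinite (α := Fin n) (M := ℕ))]
  simp only [Equiv.symm_apply_apply]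
  set S := (Fintype.piFinset fun i => (x i).support).biUnion
    fun d => (curPoly (n := n) d).support with hS
  rw [finsum_eq_sum_of_support_subset (s := S)]
  · simp only [curProd_eq_sum]
    rw [Finset.sum_comm]
    refine Finset.sum_congr rfl fun d hd => ?_
    rw [eval_curPoly_eq_sum w d (Finset.subset_biUnion_of_mem (fun d => (curPoly d).support) hd),
      map_sum, LinearMap.sum_apply]
    rfl
  · intro k hk
    rw [Function.mem_support, curProd_eq_sum] at hk
    obtain ⟨d, hd, hne⟩ := Finset.exists_ne_zero_of_sum_ne_zero hk
    rw [Finset.mem_coe, hS, Finset.mem_biUnion]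
    refine ⟨d, hd, ?_⟩
    rw [MvPolynomial.mem_support_iff]
    intro h0
    exact hne (by rw [h0]; simp)

lemma exists_curProd_curCoeff_eq_zero (br : AlternatingMap ℂ g g (Fin (n + 1)))
    (x : Fin (n + 1) → ℕ →₀ g) :
    ∃ N : ℕ, ∀ k : Fin n → ℕ, N ≤ ∑ s, k s → curProd br (curCoeff k) x = 0 := by
  classical
  refine ⟨(Fintype.piFinset fun i => (x i).support).sup
    (fun d => (curPoly d).totalDegree) + 1, fun k hk => ?_⟩
  rw [curProd_eq_sum]
  refine Finset.sum_eq_zero fun d hd => ?_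
  rw [curCoeff, MvPolynomial.coeff_eq_zero_of_totalDegree_lt]
  · simp
  · have h1 := Finset.le_sup (f := fun d => (curPoly (n := n) d).totalDegree) hd
    have h2 : ∑ s ∈ (Finsupp.equivFunOnFinite.symm k).support,
        (Finsupp.equivFunOnFinite.symm k) s = ∑ s, k s :=
      Finsupp.sum_fintype (Finsupp.equivFunOnFinite.symm k) (fun _ b => b) (fun _ => rfl)
    rw [h2]
    exact lt_of_le_of_lt h1 hk

lemma curCoeff_zero (k : Fin n → ℕ) : curCoeff k 0 = if k = 0 then 1 else 0 := by
  classical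
  have h : (0 = Finsupp.equivFunOnFinite.symm k) ↔ k = 0 := by
    rw [Equiv.eq_symm_apply, eq_comm]; rfl
  rw [curCoeff, show curPoly (0 : Fin (n + 1) → ℕ) = 1 by simp [curPoly], MvPolynomial.coeff_one]
  simp only [h]
  split_ifs with hk
  · simp [hk]
  · simp

/-- The Filippov identity, solved for a bracket nested in the first slot. -/
lemma filippov_nested_first (br : AlternatingMap ℂ g g (Fin (n + 1)))
    (hFil : ∀ (x : Fin n → g) (y : Fin (n + 1) → g),
      br (Fin.snoc x (br y))
        = ∑ i : Fin (n + 1), br (Function.update y i (br (Fin.snoc x (y i)))))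
    (a : Fin (n + 1) → g) (b : Fin n → g) :
    ∑ i : Fin (n + 1), ((-1 : ℂ) ^ (n - (i : ℕ))) •
        br (Fin.snoc (fun s => a (i.succAbove s)) (br (Fin.cons (a i) b))) =
      br (Fin.cons (br a) b) := by
  have hs (v : Fin n → g) (y : g) : br (Fin.snoc v y) = (-1 : ℂ) ^ n • br (Fin.cons y v) := by
    rw [← Fin.insertNth_last', br.map_insertNth]
    simp [Matrix.vecCons, ← Int.cast_smul_eq_zsmul ℂ]
  have hu (i : Fin (n + 1)) (y : g) : br (Function.update a i y) =
      (-1 : ℂ) ^ (i : ℕ) • br (Fin.cons y fun s => a (i.succAbove s)) := by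
    rw [← Fin.insertNth_removeNth, br.map_insertNth]
    simp [Matrix.vecCons, ← Int.cast_smul_eq_zsmul ℂ]
    rfl
  have hsq : ((-1 : ℂ) ^ n) * (-1) ^ n = 1 := by rw [← mul_pow]; simp
  have key := hFil b a
  rw [hs] at key
  have key' := congrArg (fun y => (-1 : ℂ) ^ n • y) key
  simp only [smul_smul, hsq, one_smul] at key'
  rw [key', Finset.smul_sum]
  refine Finset.sum_congr rfl fun i _ => ?_
  rw [hs, hs, br.map_update_smul, hu, smul_smul, smul_smul, smul_smul, hsq, one_mul]
  congr 1
  rw [← pow_add, show n - (i : ℕ) + n = 2 * (n - i) + i by omega, pow_add, pow_mul]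
  simp

lemma pEval_curProd [NeZero n] (br : AlternatingMap ℂ g g (Fin (n + 1))) (lam : Fin n → ℂ)
    (x : Fin (n + 1) → ℕ →₀ g) :
    pEval (fun k => curProd br (curCoeff k)) lam x =
      curProd br (fun d => MvPolynomial.eval (fun s => Polynomial.C (lam s)) (curPoly d)) x := by
  rw [← finsum_curProd]
  refine finsum_congr fun k => ?_
  have h : (∏ s, Polynomial.C ((k s).factorial : ℂ)⁻¹ * Polynomial.C (lam s) ^ k s) =
      Polynomial.C (∏ s, dPow (lam s) (k s)) := by
    rw [map_prod]
    refine Finset.prod_congr rfl fun s _ => ?_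
    rw [dPow, div_eq_inv_mul, map_mul, map_pow]
  rw [h, Polynomial.aeval_C, Module.algebraMap_end_apply]

lemma pEval_eq_curMap [NeZero n] (br : AlternatingMap ℂ g g (Fin (n + 1))) (lam : Fin n → ℂ)
    (x : Fin (n + 1) → ℕ →₀ g) :
    pEval (fun k => curProd br (curCoeff k)) lam x =
      curMap (bracketLast br fun s => curEval g (-lam s) (x s.castSucc))
        (curShift g (∑ s, lam s) (x (Fin.last n))) := by
  rw [pEval_curProd, ← curProd_eq_curMap]
  simp only [eval_curPoly, map_sum]

lemma pEvalOp_curProd [NeZero n] (br : AlternatingMap ℂ g g (Fin (n + 1))) (lam : Fin n → ℂ)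
    (c : ℂ) (x : Fin (n + 1) → ℕ →₀ g) :
    pEvalOp (curD g) (fun k => curProd br (curCoeff k)) lam c x =
      curProd br (fun d => MvPolynomial.eval (Function.update (fun s => Polynomial.C (lam s))
        (lastIdx n) (-(Polynomial.X + Polynomial.C c))) (curPoly d)) x := by
  rw [← finsum_curProd]
  refine finsum_congr fun k => ?_
  have h : (∏ s, Polynomial.C ((k s).factorial : ℂ)⁻¹ *
      Function.update (fun s => Polynomial.C (lam s)) (lastIdx n)
        (-(Polynomial.X + Polynomial.C c)) s ^ k s) =
      Polynomial.C (∏ s ∈ Finset.univ.erase (lastIdx n), dPow (lam s) (k s)) *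
        (Polynomial.C ((k (lastIdx n)).factorial : ℂ)⁻¹ *
          (-(Polynomial.X + Polynomial.C c)) ^ k (lastIdx n)) := by
    rw [← Finset.prod_erase_mul _ _ (Finset.mem_univ (lastIdx n)), Function.update_self, map_prod]
    congr 1
    refine Finset.prod_congr rfl fun s hs => ?_
    rw [Function.update_of_ne (Finset.ne_of_mem_erase hs), dPow, div_eq_inv_mul, map_mul, map_pow]
  rw [h, map_mul, map_mul, Polynomial.aeval_C, Polynomial.aeval_C, Module.End.mul_apply,
    Module.End.mul_apply, Module.algebraMap_end_apply, Module.algebraMap_end_apply, map_pow,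
    map_neg, map_add, Polynomial.aeval_X, Polynomial.aeval_C, Algebra.algebraMap_eq_smul_one]

lemma pEval_curProd_swap [NeZero n] (br : AlternatingMap ℂ g g (Fin (n + 1))) (lam : Fin n → ℂ)
    (x : Fin (n + 1) → ℕ →₀ g) {i j : Fin n} (hij : i ≠ j) :
    pEval (fun k => curProd br (curCoeff k)) (fun t => lam (Equiv.swap i j t))
        (fun t => x (Equiv.swap i.castSucc j.castSucc t)) =
      - pEval (fun k => curProd br (curCoeff k)) lam x := by
  rw [pEval_curProd, pEval_curProd,
    curProd_comp_perm _ _ _ ((Fin.castSucc_injective n).ne hij)]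
  refine congrArg (fun c => -curProd br c x) (funext fun d => ?_)
  have hlast : Equiv.swap i.castSucc j.castSucc (Fin.last n) = Fin.last n :=
    Equiv.swap_apply_of_ne_of_ne (Fin.castSucc_lt_last i).ne' (Fin.castSucc_lt_last j).ne'
  have hcast (s : Fin n) :
      Equiv.swap i.castSucc j.castSucc s.castSucc = (Equiv.swap i j s).castSucc :=
    ((Fin.castSucc_injective n).map_swap i j s).symm
  simp only [eval_curPoly, hlast, hcast]
  rw [Equiv.prod_comp (Equiv.swap i j) (fun s => (-Polynomial.C (lam s)) ^ d s.castSucc),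
    Equiv.sum_comp (Equiv.swap i j) (fun s => Polynomial.C (lam s))]

lemma pEvalOp_curProd_swap [NeZero n] (br : AlternatingMap ℂ g g (Fin (n + 1)))
    (lam : Fin n → ℂ) (x : Fin (n + 1) → ℕ →₀ g) :
    pEval (fun k => curProd br (curCoeff k)) lam x =
      - pEvalOp (curD g) (fun k => curProd br (curCoeff k)) lam (∑ s, lam s)
          (fun t => x (Equiv.swap (Fin.castSucc (lastIdx n)) (Fin.last n) t)) := by
  rw [pEval_curProd, pEvalOp_curProd, curProd_comp_perm _ _ _ (Fin.castSucc_lt_last _).ne, neg_neg]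
  refine congrArg (fun c => curProd br c x) (funext fun d => ?_)
  have herase : ∏ s ∈ Finset.univ.erase (lastIdx n),
      (-Function.update (fun s => Polynomial.C (lam s)) (lastIdx n)
          (-(Polynomial.X + Polynomial.C (∑ s, lam s))) s) ^
            d (Equiv.swap (Fin.castSucc (lastIdx n)) (Fin.last n) s.castSucc) =
      ∏ s ∈ Finset.univ.erase (lastIdx n), (-Polynomial.C (lam s)) ^ d s.castSucc := by
    refine Finset.prod_congr rfl fun s hs => ?_
    have hne := Finset.ne_of_mem_erase hs
    rw [Function.update_of_ne hne, Equiv.swap_apply_of_ne_of_ne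
      ((Fin.castSucc_injective n).ne hne) (Fin.castSucc_lt_last s).ne]
  have hsum : ∑ s ∈ Finset.univ.erase (lastIdx n),
      Function.update (fun s => Polynomial.C (lam s)) (lastIdx n)
          (-(Polynomial.X + Polynomial.C (∑ s, lam s))) s =
      ∑ s ∈ Finset.univ.erase (lastIdx n), Polynomial.C (lam s) :=
    Finset.sum_congr rfl fun s hs => by rw [Function.update_of_ne (Finset.ne_of_mem_erase hs)]
  rw [eval_curPoly, eval_curPoly,
    ← Finset.prod_erase_mul _ _ (Finset.mem_univ (lastIdx n)),
    ← Finset.prod_erase_mul (f := fun s => (-Function.update (fun s => Polynomial.C (lam s))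
      (lastIdx n) (-(Polynomial.X + Polynomial.C (∑ s, lam s))) s) ^
        d (Equiv.swap (Fin.castSucc (lastIdx n)) (Fin.last n) s.castSucc))
      _ (Finset.mem_univ (lastIdx n)), herase,
    ← Finset.sum_erase_add (f := Function.update (fun s => Polynomial.C (lam s))
      (lastIdx n) (-(Polynomial.X + Polynomial.C (∑ s, lam s))))
      _ (Finset.mem_univ (lastIdx n)), hsum, Function.update_self, Equiv.swap_apply_left,
    Equiv.swap_apply_right, map_sum,
    ← Finset.sum_erase_add (f := fun s => Polynomial.C (lam s)) _ (Finset.mem_univ (lastIdx n))]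
  ring

lemma pEval_curProd_filippov [NeZero n] (br : AlternatingMap ℂ g g (Fin (n + 1)))
    (hFil : ∀ (x : Fin n → g) (y : Fin (n + 1) → g),
      br (Fin.snoc x (br y))
        = ∑ i : Fin (n + 1), br (Function.update y i (br (Fin.snoc x (y i)))))
    (lam : Fin (n + 1) → ℂ) (mus : Fin n → ℂ) (a : Fin (n + 1) → ℕ →₀ g)
    (b : Fin n → ℕ →₀ g) :
    ∑ i : Fin (n + 1), ((-1 : ℂ) ^ (n - (i : ℕ))) •
        pEval (fun k => curProd br (curCoeff k)) (fun s => lam (i.succAbove s))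
          (Fin.snoc (fun s => a (i.succAbove s))
            (pEval (fun k => curProd br (curCoeff k)) (Function.update mus 0 (lam i))
              (Fin.cons (a i) b)))
      = pEval (fun k => curProd br (curCoeff k)) (Function.update mus 0 (∑ i, lam i))
          (Fin.cons (pEval (fun k => curProd br (curCoeff k)) (fun s => lam s.castSucc) a) b) := by
  obtain ⟨k, rfl⟩ := Nat.exists_eq_succ_of_ne_zero (NeZero.ne n)
  set α : Fin (k + 1 + 1) → g := fun i => curEval g (-lam i) (a i) with hα
  set β : Fin k → g := fun j => curEval g (-mus j.succ) (b j.castSucc) with hβ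
  set z := curShift g (∑ i, lam i + ∑ j : Fin k, mus j.succ) (b (Fin.last k)) with hz
  have hnest (c : ℂ) (y : ℕ →₀ g) :
      pEval (fun k => curProd br (curCoeff k)) (Function.update mus 0 c) (Fin.cons y b) =
        curMap (bracketLast br (Fin.cons (curEval g (-c) y) β))
          (curShift g (c + ∑ j : Fin k, mus j.succ) (b (Fin.last k))) := by
    rw [pEval_eq_curMap]
    congr 2
    · congr 1
      ext s
      cases s using Fin.cases with
      | zero => simp
      | succ j => simp [hβ]
    · simp [Fin.sum_univ_succ]
  have hfirst : curEval g (-∑ i, lam i)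
      (pEval (fun k => curProd br (curCoeff k)) (fun s => lam s.castSucc) a) = br α := by
    rw [pEval_eq_curMap, curEval_curMap, curEval_curShift, bracketLast_apply,
      Fin.sum_univ_castSucc]
    congr 1
    ext s
    cases s using Fin.lastCases <;> simp [hα]
  rw [hnest, hfirst]
  have hterm (i : Fin (k + 1 + 1)) :
      pEval (fun k => curProd br (curCoeff k)) (fun s => lam (i.succAbove s))
          (Fin.snoc (fun s => a (i.succAbove s))
            (pEval (fun k => curProd br (curCoeff k)) (Function.update mus 0 (lam i))
              (Fin.cons (a i) b))) =
        curMap (bracketLast br fun s => α (i.succAbove s))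
          (curMap (bracketLast br (Fin.cons (α i) β)) z) := by
    rw [hnest, pEval_eq_curMap]
    simp only [Fin.snoc_castSucc, Fin.snoc_last]
    rw [← curMap_curShift, curShift_curShift, hz, Fin.sum_univ_succAbove lam i,
      ← add_assoc, add_comm (lam i)]
  simp only [hterm]
  ext r
  simp only [Finsupp.finsetSum_apply, Finsupp.smul_apply, Finsupp.mapRange.linearMap_apply,
    Finsupp.mapRange_apply, bracketLast_apply, ← Fin.cons_snoc_eq_snoc_cons]
  exact filippov_nested_first br hFil α (Fin.snoc β (z r))

/-- The `n`-Lie conformal algebra structure on `Cur 𝔤`. -/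
def curNLieConfAlg [NeZero n] (br : AlternatingMap ℂ g g (Fin (n + 1)))
    (hFil : ∀ (x : Fin n → g) (y : Fin (n + 1) → g),
      br (Fin.snoc x (br y))
        = ∑ i : Fin (n + 1), br (Function.update y i (br (Fin.snoc x (y i))))) :
    NLieConfAlg n (ℕ →₀ g) where
  D := curD g
  prodl k := curProd br (curCoeff k)
  locFin := exists_curProd_curCoeff_eq_zero br
  sesq lam x i := by
    rw [pEval_eq_curMap, pEval_eq_curMap, Function.update_of_ne (Fin.castSucc_lt_last i).ne']
    ext r
    simp only [Finsupp.smul_apply, Finsupp.mapRange.linearMap_apply,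
      Finsupp.mapRange_apply, bracketLast_apply]
    set w := curShift g (∑ s, lam s) (x (Fin.last n)) r
    set y : Fin (n + 1) → g :=
      Fin.snoc (α := fun _ => g) (fun s => curEval g (-lam s) (x s.castSucc)) w with hy
    have h := br.map_update_smul y i.castSucc (-lam i) (y i.castSucc)
    rw [Function.update_eq_self] at h
    rw [← h]
    congr 1
    ext s
    cases s using Fin.lastCases with
    | last => simp [hy, Function.update_of_ne (Fin.castSucc_lt_last i).ne']
    | cast j =>
      rcases eq_or_ne j i with rfl | hj
      · simp [hy, curEval_curD]
      · simp [hy, Function.update_of_ne ((Fin.castSucc_injective n).ne hj)]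
  sesqLast lam x := by
    rw [pEval_eq_curMap, pEval_eq_curMap, Function.update_self, curShift_curD, map_add, map_smul,
      curMap_curD]
    simp
  skew lam x _ _ hij := pEval_curProd_swap br lam x hij
  skewLast := pEvalOp_curProd_swap br
  filippov := pEval_curProd_filippov br hFil

end CurrentAlgebra

/-- let `𝔤` be an `n`-Lie algebra (`n = m + 1`), i.e. a complex vector space
with an alternating `n`-linear bracket `br` satisfying the Filippov identity.  Then the
current module `Cur 𝔤 = ℂ[∂] ⊗ 𝔤` (modelled as `ℕ →₀ 𝔤`, with `∂` acting as the shift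
`∂^s ⊗ g ↦ ∂^{s+1} ⊗ g`) carries an `n`-Lie conformal algebra structure whose products
on `𝔤 ⊆ Cur 𝔤` are `g¹_{(0)}⋯_{(0)}g^n = [g¹,…,g^n]` and
`g¹_{(k₁)}⋯_{(k_{n-1})}g^n = 0` for `k₁ + ⋯ + k_{n-1} > 0`. -/
theorem stmt8 {m : ℕ} [NeZero m] {g : Type*} [AddCommGroup g] [Module ℂ g]
    (br : AlternatingMap ℂ g g (Fin (m + 1)))
    (hFil : ∀ (x : Fin m → g) (y : Fin (m + 1) → g),
      br (Fin.snoc x (br y))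
        = ∑ i : Fin (m + 1), br (Function.update y i (br (Fin.snoc x (y i))))) :
    ∃ B : NLieConfAlg m (ℕ →₀ g),
      B.D = Finsupp.lsum ℂ (fun s : ℕ => Finsupp.lsingle (s + 1)) ∧
      (∀ a : Fin (m + 1) → g,
        B.prodl 0 (fun i => Finsupp.single 0 (a i)) = Finsupp.single 0 (br a)) ∧
      (∀ k : Fin m → ℕ, k ≠ 0 →
        ∀ a : Fin (m + 1) → g, B.prodl k (fun i => Finsupp.single 0 (a i)) = 0) := by
  refine ⟨curNLieConfAlg br hFil, rfl, fun a => ?_, fun k hk a => ?_⟩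
  · refine (curProd_single br (curCoeff 0) 0 a).trans ?_
    simp [curCoeff_zero]
  · refine (curProd_single br (curCoeff k) 0 a).trans ?_
    simp [curCoeff_zero, hk]
end
end

section
/- Let 𝔤 be an n-Lie algebra. The current n-Lie conformal algebra Cur 𝔤 = ℂ[∂] ⊗ 𝔤 is simple (i.e., non-commutative and has no nonzero proper ideals) if and only if 𝔤 is a simple n-Lie algebra. -/
noncomputable section

open Finset

variable {m : ℕ} [NeZero m] {R : Type*} [AddCommGroup R] [Module ℂ R]

/-- An ideal of an `n`-Lie conformal algebra: a `ℂ[∂]`-submodule closed under all the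
conformal products with arbitrary elements in any slot. -/
def IsConfIdeal {m : ℕ} [NeZero m] {R : Type*} [AddCommGroup R] [Module ℂ R]
    (B : NLieConfAlg m R) (I : Submodule ℂ R) : Prop :=
  (∀ r ∈ I, B.D r ∈ I) ∧
  ∀ (k : Fin m → ℕ) (x : Fin (m + 1) → R) (i : Fin (m + 1)) (r : R), r ∈ I →
    B.prodl k (Function.update x i r) ∈ I

/-- Simplicity of an `n`-Lie conformal algebra: non-commutative and without nonzero
proper ideals. -/
def IsSimpleConf {m : ℕ} [NeZero m] {R : Type*} [AddCommGroup R] [Module ℂ R]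
    (B : NLieConfAlg m R) : Prop :=
  (∃ (k : Fin m → ℕ) (x : Fin (m + 1) → R), B.prodl k x ≠ 0) ∧
  ∀ I : Submodule ℂ R, IsConfIdeal B I → I = ⊥ ∨ I = ⊤

/-- Simplicity of an `n`-Lie algebra: nonzero bracket and no nonzero proper ideals. -/
def IsSimpleNLie {m : ℕ} {g : Type*} [AddCommGroup g] [Module ℂ g]
    (br : AlternatingMap ℂ g g (Fin (m + 1))) : Prop :=
  (∃ a : Fin (m + 1) → g, br a ≠ 0) ∧
  ∀ J : Submodule ℂ g,
    (∀ (x : Fin (m + 1) → g) (i : Fin (m + 1)) (r : g), r ∈ J →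
      br (Function.update x i r) ∈ J) → J = ⊥ ∨ J = ⊤

/-- If the values of a vector-valued polynomial over an infinite field all lie in a subspace,
then so do its coefficients. -/
theorem Submodule.coeff_mem_of_forall_eval_mem {K V σ ι : Type*} [Field K] [Infinite K]
    [AddCommGroup V] [Module K V] (P : Submodule K V) (S : Finset ι) {e : ι → σ →₀ ℕ}
    (he : Function.Injective e) (c : ι → V)
    (h : ∀ z : σ → K, ∑ i ∈ S, ((e i).prod fun t n => z t ^ n) • c i ∈ P) {i : ι} (hi : i ∈ S) :
    c i ∈ P := by
  classical
  by_contra hc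
  obtain ⟨φ, hφ, hP⟩ := Submodule.exists_le_ker_of_notMem hc
  have hp : ∑ j ∈ S, MvPolynomial.monomial (e j) (φ (c j)) = 0 := by
    refine MvPolynomial.funext fun z => ?_
    have hz := hP (h z)
    rw [LinearMap.mem_ker, map_sum] at hz
    simpa [MvPolynomial.eval_monomial, mul_comm] using hz
  have hcoeff := congrArg (MvPolynomial.coeff (e i)) hp
  rw [MvPolynomial.coeff_sum, Finset.sum_eq_single i] at hcoeff
  · exact hφ (by simpa using hcoeff)
  · intro j _ hj
    rw [MvPolynomial.coeff_monomial, if_neg fun heq => hj (he heq)]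
  · exact fun h' => absurd hi h'

namespace NLieConfAlg

variable (B : NLieConfAlg m R)

theorem finite_support_prodl (x : Fin (m + 1) → R) :
    (Function.support fun k => B.prodl k x).Finite := by
  obtain ⟨N, hN⟩ := B.locFin x
  refine (Set.finite_Iic fun _ : Fin m => N).subset fun k hk => ?_
  by_contra hle
  obtain ⟨i, hi⟩ : ∃ i, N < k i := by simpa [Pi.le_def] using hle
  exact hk (hN k (hi.le.trans (Finset.single_le_sum (fun _ _ => Nat.zero_le _) (mem_univ i))))

theorem finite_support_pEval_term (lam : Fin m → ℂ) (x : Fin (m + 1) → R) :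
    (Function.support fun k : Fin m → ℕ => (∏ s, dPow (lam s) (k s)) • B.prodl k x).Finite :=
  (B.finite_support_prodl x).subset fun _ hk h0 => hk (by simp only [h0, smul_zero])

theorem pEval_mem {P : Submodule ℂ R} {x : Fin (m + 1) → R} (h : ∀ k, B.prodl k x ∈ P)
    (lam : Fin m → ℂ) : pEval B.prodl lam x ∈ P :=
  finsum_induction (· ∈ P) P.zero_mem (fun _ _ => P.add_mem) fun k => P.smul_mem _ (h k)

theorem prodl_mem_of_pEval_mem {P : Submodule ℂ R} {x : Fin (m + 1) → R}
    (h : ∀ lam, pEval B.prodl lam x ∈ P) (k : Fin m → ℕ) : B.prodl k x ∈ P := by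
  by_cases hk : B.prodl k x = 0
  · simp [hk]
  have hfac : (∏ s, ((k s).factorial : ℂ)⁻¹) ≠ 0 :=
    Finset.prod_ne_zero_iff.2 fun s _ => inv_ne_zero (Nat.cast_ne_zero.2 (k s).factorial_ne_zero)
  refine (P.smul_mem_iff hfac).1 ?_
  refine P.coeff_mem_of_forall_eval_mem (B.finite_support_prodl x).toFinset
    (e := Finsupp.equivFunOnFinite.symm) (Equiv.injective _)
    (fun k => (∏ s, ((k s).factorial : ℂ)⁻¹) • B.prodl k x) (fun z => ?_) (by simpa using hk)
  convert h z using 1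
  rw [pEval, finsum_eq_sum_of_support_subset (s := (B.finite_support_prodl x).toFinset)]
  · refine Finset.sum_congr rfl fun k _ => ?_
    rw [smul_smul, Finsupp.prod_fintype _ _ fun _ => pow_zero _, ← Finset.prod_mul_distrib]
    rfl
  · intro k hk
    simp only [Set.Finite.coe_toFinset, Function.mem_support] at hk ⊢
    exact fun h0 => hk (by rw [h0, smul_zero])

theorem pEval_update_sum {ι : Type*} (lam : Fin m → ℂ) (x : Fin (m + 1) → R) (i : Fin (m + 1))
    (S : Finset ι) (y : ι → R) :
    pEval B.prodl lam (Function.update x i (∑ j ∈ S, y j))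
      = ∑ j ∈ S, pEval B.prodl lam (Function.update x i (y j)) := by
  simp only [pEval, MultilinearMap.map_update_sum, Finset.smul_sum]
  exact finsum_sum_comm _ _ fun j _ => B.finite_support_pEval_term lam _

theorem pEval_update_D_mem {P : Submodule ℂ R} (hP : ∀ r ∈ P, B.D r ∈ P) {x : Fin (m + 1) → R}
    (h : ∀ lam, pEval B.prodl lam x ∈ P) (i : Fin (m + 1)) (lam : Fin m → ℂ) :
    pEval B.prodl lam (Function.update x i (B.D (x i))) ∈ P := by
  induction i using Fin.lastCases with
  | last =>
    rw [B.sesqLast]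
    exact P.add_mem (hP _ (h lam)) (P.smul_mem _ (h lam))
  | cast i =>
    rw [B.sesq]
    exact P.smul_mem _ (h lam)

section Current

variable {g : Type*} [AddCommGroup g] [Module ℂ g] {br : AlternatingMap ℂ g g (Fin (m + 1))}
  {B : NLieConfAlg m (ℕ →₀ g)}

theorem pEval_single_zero
    (h0 : ∀ a : Fin (m + 1) → g,
      B.prodl 0 (fun i => Finsupp.single 0 (a i)) = Finsupp.single 0 (br a))
    (hk : ∀ k : Fin m → ℕ, k ≠ 0 →
      ∀ a : Fin (m + 1) → g, B.prodl k (fun i => Finsupp.single 0 (a i)) = 0)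
    (lam : Fin m → ℂ) (a : Fin (m + 1) → g) :
    pEval B.prodl lam (fun i => Finsupp.single 0 (a i)) = Finsupp.single 0 (br a) := by
  rw [pEval, finsum_eq_single _ 0 fun k hk0 => by rw [hk k hk0, smul_zero], h0]
  simp [dPow]

theorem pEval_single_mem (hD : ∀ s (a : g), B.D (Finsupp.single s a) = Finsupp.single (s + 1) a)
    {P : Submodule ℂ (ℕ →₀ g)} (hP : ∀ r ∈ P, B.D r ∈ P) {a : Fin (m + 1) → g}
    (h : ∀ lam, pEval B.prodl lam (fun i => Finsupp.single 0 (a i)) ∈ P)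
    (s : Fin (m + 1) → ℕ) (lam : Fin m → ℂ) :
    pEval B.prodl lam (fun i => Finsupp.single (s i) (a i)) ∈ P := by
  induction hN : ∑ i, s i generalizing s lam with
  | zero =>
    obtain rfl : s = fun _ => 0 := funext fun i => by simpa using (Finset.sum_eq_zero_iff.1 hN) i
    exact h lam
  | succ N ih =>
    obtain ⟨i, hi⟩ : ∃ i, s i ≠ 0 := by
      by_contra! hs
      simp [hs] at hN
    have hs : s = Function.update s i (s i - 1) + Pi.single i 1 := by
      ext j
      rcases eq_or_ne j i with rfl | hj
      · simp; omega
      · simp [hj]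
    have hsum : ∑ j, Function.update s i (s i - 1) j = N := by
      have := congrArg (fun t => ∑ j, t j) hs
      simp only [Pi.add_apply, Finset.sum_add_distrib, Finset.sum_pi_single', mem_univ, if_true,
        hN] at this
      simp at this
      omega
    convert B.pEval_update_D_mem hP (fun lam => ih _ lam hsum) i lam using 2
    ext1 j
    rcases eq_or_ne j i with rfl | hj
    · simp only [Function.update_self, hD]
      congr 1
      omega
    · simp [hj]

theorem prodl_mem_of_single_bracket_mem
    (hD : ∀ s (a : g), B.D (Finsupp.single s a) = Finsupp.single (s + 1) a)
    (h0 : ∀ a : Fin (m + 1) → g,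
      B.prodl 0 (fun i => Finsupp.single 0 (a i)) = Finsupp.single 0 (br a))
    (hk : ∀ k : Fin m → ℕ, k ≠ 0 →
      ∀ a : Fin (m + 1) → g, B.prodl k (fun i => Finsupp.single 0 (a i)) = 0)
    {P : Submodule ℂ (ℕ →₀ g)} (hP : ∀ r ∈ P, B.D r ∈ P) {x : Fin (m + 1) → ℕ →₀ g}
    (h : ∀ s : Fin (m + 1) → ℕ, Finsupp.single 0 (br fun i => x i (s i)) ∈ P)
    (k : Fin m → ℕ) : B.prodl k x ∈ P := by
  have hx : x = fun i => ∑ s ∈ (x i).support, Finsupp.single s (x i s) :=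
    funext fun i => (Finsupp.sum_single (x i)).symm
  rw [hx, MultilinearMap.map_sum_finset]
  refine P.sum_mem fun s _ => B.prodl_mem_of_pEval_mem (fun lam => ?_) k
  refine pEval_single_mem hD hP (fun lam => ?_) s lam
  rw [pEval_single_zero h0 hk]
  exact h s

theorem pEval_update_single
    (hD : ∀ s (a : g), B.D (Finsupp.single s a) = Finsupp.single (s + 1) a)
    (lam : Fin m → ℂ) (x : Fin (m + 1) → ℕ →₀ g) (i : Fin m) (s : ℕ) (b : g) :
    pEval B.prodl lam (Function.update x i.castSucc (Finsupp.single s b))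
      = (-lam i) ^ s • pEval B.prodl lam (Function.update x i.castSucc (Finsupp.single 0 b)) := by
  induction s with
  | zero => simp
  | succ s ih =>
    have h := B.sesq lam (Function.update x i.castSucc (Finsupp.single s b)) i
    rw [Function.update_self, Function.update_idem, hD, ih, smul_smul] at h
    rw [h, pow_succ']

/-- A conformal ideal containing `f` contains all brackets of the coefficients of `f` with
elements of `g`. -/
theorem single_bracket_coeff_mem
    (hD : ∀ s (a : g), B.D (Finsupp.single s a) = Finsupp.single (s + 1) a)
    (h0 : ∀ a : Fin (m + 1) → g,
      B.prodl 0 (fun i => Finsupp.single 0 (a i)) = Finsupp.single 0 (br a))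
    (hk : ∀ k : Fin m → ℕ, k ≠ 0 →
      ∀ a : Fin (m + 1) → g, B.prodl k (fun i => Finsupp.single 0 (a i)) = 0)
    {I : Submodule ℂ (ℕ →₀ g)} (hI : IsConfIdeal B I) {f : ℕ →₀ g} (hf : f ∈ I)
    (x : Fin (m + 1) → g) (i : Fin m) (s : ℕ) :
    Finsupp.single 0 (br (Function.update x i.castSucc (f s))) ∈ I := by
  by_cases hs : s ∈ f.support
  swap
  · rw [Finsupp.notMem_support_iff.1 hs, br.map_update_zero, Finsupp.single_zero]
    exact I.zero_mem
  have hsign : ((-1 : ℂ) ^ s) ≠ 0 := pow_ne_zero _ (by norm_num)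
  refine (I.smul_mem_iff hsign).1 ?_
  refine I.coeff_mem_of_forall_eval_mem f.support
    (e := fun s => Finsupp.single () s) (Finsupp.single_injective ())
    (fun s => (-1 : ℂ) ^ s • Finsupp.single 0 (br (Function.update x i.castSucc (f s))))
    (fun z => ?_) hs
  have hmem := B.pEval_mem
    (fun k => hI.2 k (fun j => Finsupp.single 0 (x j)) i.castSucc f hf) (fun _ => z ())
  rw [← Finsupp.sum_single f, Finsupp.sum, B.pEval_update_sum] at hmem
  convert hmem using 1
  refine Finset.sum_congr rfl fun s _ => ?_
  rw [pEval_update_single hD]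
  have hupd : Function.update (fun j => Finsupp.single 0 (x j)) i.castSucc (Finsupp.single 0 (f s))
      = fun j => (Finsupp.single 0 (Function.update x i.castSucc (f s) j) : ℕ →₀ g) := by
    ext1 j
    rcases eq_or_ne j i.castSucc with rfl | hj
    · simp
    · simp [hj]
  rw [hupd, pEval_single_zero h0 hk, smul_smul, Finsupp.prod_single_index (h := fun t n => z t ^ n) (pow_zero _),
    ← mul_pow, mul_neg_one]

end Current

end NLieConfAlg

/-- In a simple `n`-Lie algebra, an element whose brackets all vanish is zero. -/
theorem IsSimpleNLie.eq_zero_of_bracket_eq_zero {n : ℕ} {g : Type*} [AddCommGroup g] [Module ℂ g]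
    {br : AlternatingMap ℂ g g (Fin (n + 1))} (h : IsSimpleNLie br) {i : Fin (n + 1)} {b : g}
    (hb : ∀ x : Fin (n + 1) → g, br (Function.update x i b) = 0) : b = 0 := by
  have hswap : ∀ (j : Fin (n + 1)) (c : g),
      (∀ x : Fin (n + 1) → g, br (Function.update x i c) = 0) →
      ∀ x : Fin (n + 1) → g, br (Function.update x j c) = 0 := by
    intro j c hc x
    rcases eq_or_ne i j with rfl | hij
    · exact hc x
    have hval := hc (Function.update x j c ∘ Equiv.swap i j)
    have hupd : Function.update (Function.update x j c ∘ Equiv.swap i j) i c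
        = Function.update x j c ∘ Equiv.swap i j := by
      rw [Function.update_eq_self_iff]
      simp
    rw [hupd, br.map_swap _ hij] at hval
    exact neg_eq_zero.1 hval
  let Z : Submodule ℂ g :=
    { carrier := {c | ∀ x : Fin (n + 1) → g, br (Function.update x i c) = 0}
      add_mem' := fun hc hd x => by rw [br.map_update_add, hc x, hd x, add_zero]
      zero_mem' := fun x => br.map_update_zero x i
      smul_mem' := fun t c hc x => by rw [br.map_update_smul, hc x, smul_zero] }
  rcases h.2 Z (fun x j r hr y => by
    rw [hswap j r hr x, br.map_update_zero]) with hZ | hZ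
  · exact (Submodule.mem_bot ℂ).1 (hZ ▸ (show b ∈ Z from hb))
  · obtain ⟨a, ha⟩ := h.1
    have hmem : a i ∈ Z := hZ ▸ Submodule.mem_top
    exact absurd (by simpa using hmem a) ha

/-- for an `n`-Lie algebra `𝔤` (`n = m + 1`), the current `n`-Lie conformal
algebra `Cur 𝔤 = ℂ[∂] ⊗ 𝔤` (modelled as `ℕ →₀ 𝔤`, with `∂` the shift, products determined
by `g¹_{(0)}⋯g^n = [g¹,…,g^n]` and vanishing higher products on `𝔤`) is simple iff `𝔤`
is a simple `n`-Lie algebra. -/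
theorem stmt9 {m : ℕ} [NeZero m] {g : Type*} [AddCommGroup g] [Module ℂ g]
    (br : AlternatingMap ℂ g g (Fin (m + 1)))
    (hFil : ∀ (x : Fin m → g) (y : Fin (m + 1) → g),
      br (Fin.snoc x (br y))
        = ∑ i : Fin (m + 1), br (Function.update y i (br (Fin.snoc x (y i)))))
    (B : NLieConfAlg m (ℕ →₀ g))
    (hD : B.D = Finsupp.lsum ℂ (fun s : ℕ => Finsupp.lsingle (s + 1)))
    (h0 : ∀ a : Fin (m + 1) → g,
      B.prodl 0 (fun i => Finsupp.single 0 (a i)) = Finsupp.single 0 (br a))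
    (hk : ∀ k : Fin m → ℕ, k ≠ 0 →
      ∀ a : Fin (m + 1) → g, B.prodl k (fun i => Finsupp.single 0 (a i)) = 0) :
    IsSimpleConf B ↔ IsSimpleNLie br := by
  have hD' : ∀ s (a : g), B.D (Finsupp.single s a) = Finsupp.single (s + 1) a := by
    intro s a
    simp [hD]
  constructor
  · rintro ⟨⟨k, x, hkx⟩, hideal⟩
    refine ⟨?_, fun J hJ => ?_⟩
    · by_contra! hbr
      refine hkx ((Submodule.mem_bot ℂ).1 ?_)
      exact NLieConfAlg.prodl_mem_of_single_bracket_mem hD' h0 hk (by simp) (by simp [hbr]) k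
    · have hsingle : ∀ s {a : g}, a ∈ J →
          Finsupp.single s a ∈ Finsupp.submodule fun _ : ℕ => J := by
        intro s a ha
        rw [Finsupp.mem_submodule_iff]
        intro t
        rw [Finsupp.single_apply]
        split_ifs
        exacts [ha, J.zero_mem]
      have hDJ : ∀ r ∈ Finsupp.submodule fun _ : ℕ => J,
          B.D r ∈ Finsupp.submodule fun _ : ℕ => J := by
        intro r hr
        rw [hD, Finsupp.lsum_apply]
        exact Submodule.sum_mem _ fun s _ =>
          hsingle (s + 1) ((Finsupp.mem_submodule_iff _ _).1 hr s)
      have hJideal : IsConfIdeal B (Finsupp.submodule fun _ : ℕ => J) := by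
        refine ⟨hDJ, fun k x i r hr => ?_⟩
        refine NLieConfAlg.prodl_mem_of_single_bracket_mem hD' h0 hk hDJ
          (fun s => hsingle 0 ?_) k
        have hmem := hJ (fun j => Function.update x i r j (s j)) i (r (s i))
          ((Finsupp.mem_submodule_iff _ _).1 hr (s i))
        rwa [Function.update_eq_self_iff.2 (by simp)] at hmem
      rcases hideal _ hJideal with hI | hI
      · left
        rw [Submodule.eq_bot_iff]
        intro a ha
        have hmem := hsingle 0 ha
        rw [hI, Submodule.mem_bot] at hmem
        exact Finsupp.single_eq_zero.1 hmem
      · right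
        rw [Submodule.eq_top_iff']
        intro a
        have hmem : Finsupp.single 0 a ∈ Finsupp.submodule fun _ : ℕ => J :=
          hI ▸ Submodule.mem_top
        simpa using (Finsupp.mem_submodule_iff _ _).1 hmem 0
  · intro h
    obtain ⟨a, ha⟩ := h.1
    refine ⟨⟨0, fun i => Finsupp.single 0 (a i), ?_⟩, fun I hI => ?_⟩
    · rwa [h0, Ne, Finsupp.single_eq_zero]
    let J : Submodule ℂ g := I.comap (Finsupp.lsingle 0)
    have hJ : ∀ (x : Fin (m + 1) → g) (i : Fin (m + 1)) (r : g), r ∈ J →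
        br (Function.update x i r) ∈ J := by
      intro x i r hr
      have hmem := hI.2 0 (fun j => Finsupp.single 0 (Function.update x i r j)) i
        (Finsupp.single 0 r) hr
      rwa [Function.update_eq_self_iff.2 (by simp), h0] at hmem
    rcases h.2 J hJ with hbot | htop
    · left
      rw [Submodule.eq_bot_iff]
      intro f hf
      ext s
      refine h.eq_zero_of_bracket_eq_zero (i := (0 : Fin m).castSucc) fun x => ?_
      have hmem : br (Function.update x (0 : Fin m).castSucc (f s)) ∈ J :=
        NLieConfAlg.single_bracket_coeff_mem hD' h0 hk hI hf x 0 s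
      rwa [hbot, Submodule.mem_bot] at hmem
    · right
      have hmem : ∀ s (a : g), Finsupp.single s a ∈ I := by
        intro s a
        induction s with
        | zero => exact (htop ▸ Submodule.mem_top : a ∈ J)
        | succ s ih => exact hD' s a ▸ hI.1 _ ih
      rw [Submodule.eq_top_iff']
      intro f
      rw [← Finsupp.sum_single f]
      exact I.sum_mem fun s _ => hmem s (f s)
end
end

section
/- Let R be an n-Lie conformal algebra, and let R̃ = R[t, t⁻¹] be the ℂ[∂̃]-module with ∂̃ = ∂ ⊗ 1 + 1 ⊗ ∂ₜ. Define (a¹⊗f₁)_{(k₁)}⋯_{(k_{n-1})}(aⁿ⊗fₙ) = Σ_{j₁,…,j_{n-1}≥0} (a¹_{(k₁+j₁)}⋯_{(k_{n-1}+j_{n-1})}aⁿ) ⊗ (∂ₜ^{(j₁)}f₁)⋯(∂ₜ^{(j_{n-1})}f_{n-1})fₙ, where ∂ₜ^{(j)} = ∂ₜʲ/j!. Then R̃ with these products is an n-Lie conformal algebra. -/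
noncomputable section

open Finset

variable {m : ℕ} [NeZero m] {R : Type*} [AddCommGroup R] [Module ℂ R]

/-- Generalized binomial coefficient `binom(z, k) = z(z-1)⋯(z-k+1)/k!` for `z ∈ ℤ`,
so that `∂ₜ^{(k)} t^z = binom(z, k) t^{z-k}`. -/
def genChoose (z : ℤ) (k : ℕ) : ℂ :=
  (∏ i ∈ Finset.range k, ((z : ℂ) - (i : ℂ))) / (k.factorial : ℂ)

set_option linter.unusedSectionVars false

section DividedPowers

variable {C : Type*} [CommRing C] [Algebra ℂ C] {ι : Type*} [Fintype ι] [DecidableEq ι]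

/-- Divided power `z ^ k / k!` in a commutative `ℂ`-algebra. -/
def divPow (z : C) (k : ℕ) : C := ((k.factorial : ℂ)⁻¹) • z ^ k

/-- Product of divided powers `∏ i, (z i) ^ (k i) / (k i)!`. -/
def divMon (z : ι → C) (k : ι → ℕ) : C := ∏ i, divPow (z i) (k i)

@[simp] theorem divPow_zero (z : C) : divPow z 0 = 1 := by simp [divPow]

theorem mul_divPow (z : C) (k : ℕ) : z * divPow z k = ((k + 1 : ℕ) : ℂ) • divPow z (k + 1) := by
  have h : ((k + 1 : ℕ) : ℂ) ≠ 0 := Nat.cast_ne_zero.2 k.succ_ne_zero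
  rw [divPow, divPow, smul_smul, Nat.factorial_succ, Nat.cast_mul, mul_inv, ← mul_assoc,
    mul_inv_cancel₀ h, one_mul, mul_smul_comm, pow_succ']

theorem divPow_add (x y : C) (n : ℕ) :
    divPow (x + y) n = ∑ p ∈ antidiagonal n, divPow x p.1 * divPow y p.2 := by
  rw [divPow, (Commute.all x y).add_pow', smul_sum]
  refine sum_congr rfl fun p hp => ?_
  obtain rfl := mem_antidiagonal.1 hp
  have h1 : ((p.1).factorial : ℂ) ≠ 0 := Nat.cast_ne_zero.2 (Nat.factorial_ne_zero _)
  have h2 : ((p.2).factorial : ℂ) ≠ 0 := Nat.cast_ne_zero.2 (Nat.factorial_ne_zero _)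
  have h3 : ((p.1 + p.2).factorial : ℂ) ≠ 0 := Nat.cast_ne_zero.2 (Nat.factorial_ne_zero _)
  rw [divPow, divPow, smul_mul_smul_comm, ← Nat.cast_smul_eq_nsmul ℂ, smul_smul]
  congr 1
  have h := Nat.add_choose_mul_factorial_mul_factorial p.1 p.2
  rw [← Nat.choose_symm_add] at h
  rw [← Nat.cast_inj (R := ℂ)] at h
  push_cast at h
  field_simp
  linear_combination h

theorem dPow_eq_divPow (z : ℂ) (k : ℕ) : dPow z k = divPow z k := by
  rw [dPow, divPow, smul_eq_mul, div_eq_inv_mul]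

theorem divMon_add (z w : ι → C) (n : ι → ℕ) :
    divMon (z + w) n = ∑ x ∈ Fintype.piFinset fun i => antidiagonal (n i),
      divMon z (fun i => (x i).1) * divMon w (fun i => (x i).2) := by
  simp only [divMon, Pi.add_apply, divPow_add, ← prod_mul_distrib]
  rw [prod_univ_sum]

theorem map_divPow {C' : Type*} [CommRing C'] [Algebra ℂ C'] (f : C →ₐ[ℂ] C') (z : C) (k : ℕ) :
    f (divPow z k) = divPow (f z) k := by
  simp [divPow]

theorem map_divMon {C' : Type*} [CommRing C'] [Algebra ℂ C'] (f : C →ₐ[ℂ] C') (z : ι → C)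
    (k : ι → ℕ) : f (divMon z k) = divMon (fun i => f (z i)) k := by
  simp [divMon, map_divPow]

theorem mul_divMon (z : ι → C) (k : ι → ℕ) (i : ι) :
    z i * divMon z k = ((k i + 1 : ℕ) : ℂ) • divMon z (Function.update k i (k i + 1)) := by
  rw [divMon, divMon, ← mul_prod_erase univ _ (mem_univ i), ← mul_prod_erase univ _ (mem_univ i),
    ← mul_assoc, mul_divPow, Function.update_self, smul_mul_assoc]
  congr 2
  refine prod_congr rfl fun j hj => ?_
  rw [Function.update_of_ne (ne_of_mem_erase hj)]

end DividedPowers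

section FiniteSums

variable {ι : Type*} [Fintype ι] [DecidableEq ι] {V W : Type*} [AddCommGroup V]
  [AddCommGroup W]

/-- A function on multi-indices vanishing in large total degree. -/
def VanishesFrom (g : (ι → ℕ) → V) (N : ℕ) : Prop := ∀ k, N ≤ ∑ i, k i → g k = 0

/-- The box of multi-indices with all entries less than `N`. -/
def multiBox (ι : Type*) [Fintype ι] [DecidableEq ι] (N : ℕ) : Finset (ι → ℕ) :=
  Fintype.piFinset fun _ => range N

theorem le_sum_of_notMem_multiBox {N : ℕ} {k : ι → ℕ} (hk : k ∉ multiBox ι N) :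
    N ≤ ∑ i, k i := by
  simp only [multiBox, Fintype.mem_piFinset, mem_range, not_forall, not_lt] at hk
  obtain ⟨i, hi⟩ := hk
  exact hi.trans (single_le_sum (f := k) (fun _ _ => Nat.zero_le _) (mem_univ i))

theorem VanishesFrom.finsum_eq {g : (ι → ℕ) → V} {N : ℕ} (hg : VanishesFrom g N) :
    ∑ᶠ k, g k = ∑ k ∈ multiBox ι N, g k := by
  refine finsum_eq_sum_of_support_subset _ fun k hk => ?_
  by_contra h
  exact hk (hg k (le_sum_of_notMem_multiBox h))

theorem VanishesFrom.finite_support {g : (ι → ℕ) → V} {N : ℕ} (hg : VanishesFrom g N) :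
    (Function.support g).Finite := by
  refine (multiBox ι N).finite_toSet.subset fun k hk => ?_
  by_contra h
  exact hk (hg k (le_sum_of_notMem_multiBox h))

theorem VanishesFrom.mono {g : (ι → ℕ) → V} {N N' : ℕ} (hg : VanishesFrom g N) (h : N ≤ N') :
    VanishesFrom g N' := fun k hk => hg k (h.trans hk)

theorem VanishesFrom.shift {g : (ι → ℕ) → V} {N : ℕ} (hg : VanishesFrom g N) (k : ι → ℕ) :
    VanishesFrom (fun j => g (k + j)) N := fun j hj => hg _ <| by
  simp only [Pi.add_apply, sum_add_distrib]
  omega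

theorem VanishesFrom.map {g : (ι → ℕ) → V} {N : ℕ} (hg : VanishesFrom g N)
    (f : (ι → ℕ) → V →+ W) : VanishesFrom (fun k => f k (g k)) N := fun k hk => by
  simp [hg k hk]

/-- The Taylor expansion of a finite generating series in divided powers. -/
theorem finsum_divMon_add {C : Type*} [CommRing C] [Algebra ℂ C] (L : C →+ (V →+ W))
    (z w : ι → C) {g : (ι → ℕ) → V} {N : ℕ} (hg : VanishesFrom g N) :
    ∑ᶠ n, L (divMon (z + w) n) (g n)
      = ∑ᶠ k, ∑ᶠ j, L (divMon z k * divMon w j) (g (k + j)) := by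
  rw [(hg.map fun n => L (divMon (z + w) n)).finsum_eq]
  have hR : ∀ k, ∑ᶠ j, L (divMon z k * divMon w j) (g (k + j))
      = ∑ j ∈ multiBox ι N, L (divMon z k * divMon w j) (g (k + j)) := fun k =>
    ((hg.shift k).map fun j => L (divMon z k * divMon w j)).finsum_eq
  have hv : VanishesFrom (fun k => ∑ᶠ j, L (divMon z k * divMon w j) (g (k + j))) N := by
    intro k hk
    refine (finsum_congr fun j => ?_).trans finsum_zero
    rw [hg (k + j), map_zero]
    simp only [Pi.add_apply, sum_add_distrib]
    omega
  rw [hv.finsum_eq]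
  simp only [hR]
  rw [← sum_product']
  rw [← sum_filter_of_ne (s := multiBox ι N ×ˢ multiBox ι N)
    (p := fun x : (ι → ℕ) × (ι → ℕ) => x.1 + x.2 ∈ multiBox ι N)]
  · rw [← sum_fiberwise_of_maps_to (t := multiBox ι N)
      (g := fun x : (ι → ℕ) × (ι → ℕ) => x.1 + x.2)]
    · refine sum_congr rfl fun n hn => ?_
      rw [divMon_add, map_sum, AddMonoidHom.finsetSum_apply]
      refine sum_bij' (fun x _ => (fun i => (x i).1, fun i => (x i).2))
        (fun p _ i => (p.1 i, p.2 i)) ?_ ?_ ?_ ?_ ?_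
      · intro x hx
        simp only [Fintype.mem_piFinset, HasAntidiagonal.mem_antidiagonal] at hx
        simp only [multiBox, Fintype.mem_piFinset, mem_range] at hn
        have h : (fun i => (x i).1) + (fun i => (x i).2) = n := funext hx
        simp only [mem_filter, mem_product, multiBox, Fintype.mem_piFinset, mem_range, h, hn,
          implies_true, and_true]
        exact ⟨fun i => by have := hx i; have := hn i; omega,
          fun i => by have := hx i; have := hn i; omega⟩
      · intro p hp
        simp only [mem_filter] at hp
        simp [← hp.2]
      · intro x _; rfl
      · intro p _; rfl
      · intro x hx
        simp only [Fintype.mem_piFinset, HasAntidiagonal.mem_antidiagonal] at hx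
        have h : (fun i => (x i).1) + (fun i => (x i).2) = n := funext hx
        simp only [h]
    · intro x hx
      exact (mem_filter.1 hx).2
  · intro x _ hx
    by_contra h
    exact hx (by rw [hg _ (le_sum_of_notMem_multiBox h), map_zero])

end FiniteSums

section PolynomialFunctions

variable {ι : Type*} [Fintype ι] [DecidableEq ι] {V : Type*} [AddCommGroup V] [Module ℂ V]

variable (ι V) in
/-- The vector-valued polynomial function with given coefficients in the divided power basis. -/
def polyEmb : ((ι → ℕ) →₀ V) →ₗ[ℂ] ((ι → ℂ) → V) :=
  Finsupp.lsum ℂ fun k => LinearMap.pi fun α => divMon α k • LinearMap.id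

theorem polyEmb_single (k : ι → ℕ) (v : V) :
    polyEmb ι V (Finsupp.single k v) = fun α => divMon α k • v := by
  ext α
  simp [polyEmb]

theorem ker_polyEmb : LinearMap.ker (polyEmb ι V) = ⊥ := by
  rw [LinearMap.ker_eq_bot']
  intro f hf
  ext k
  rw [Finsupp.zero_apply, ← Module.forall_dual_apply_eq_zero_iff ℂ]
  intro φ
  let e := (Finsupp.equivFunOnFinite : (ι →₀ ℕ) ≃ (ι → ℕ)).symm
  let p : MvPolynomial ι ℂ := ∑ k ∈ f.support,
    MvPolynomial.monomial (e k) (φ (f k) * ∏ i, ((k i).factorial : ℂ)⁻¹)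
  have hp : p = 0 := by
    refine MvPolynomial.funext fun α => ?_
    have h := congrArg φ (congrFun hf α)
    simp only [polyEmb, Finsupp.lsum_apply, Finsupp.sum, Finset.sum_apply, map_sum,
      LinearMap.pi_apply, LinearMap.smul_apply, LinearMap.id_apply, map_smul, Pi.zero_apply,
      map_zero] at h
    rw [map_zero, ← h, map_sum]
    refine sum_congr rfl fun k _ => ?_
    rw [MvPolynomial.eval_monomial, Finsupp.prod_fintype _ _ (fun i => pow_zero _)]
    simp only [divMon, divPow, smul_eq_mul, prod_mul_distrib]
    simp only [e, Finsupp.equivFunOnFinite_symm_apply_apply]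
    ring
  have hc := congrArg (MvPolynomial.coeff (e k)) hp
  simp only [p, MvPolynomial.coeff_sum, MvPolynomial.coeff_monomial, MvPolynomial.coeff_zero,
    e.injective.eq_iff, sum_ite_eq', Finsupp.mem_support_iff] at hc
  split_ifs at hc with h
  · refine (mul_eq_zero.1 hc).resolve_right (prod_ne_zero_iff.2 fun i _ => ?_)
    exact inv_ne_zero (Nat.cast_ne_zero.2 (Nat.factorial_ne_zero _))
  · rw [Finsupp.notMem_support_iff.1 h, map_zero]

variable (ι V) in
/-- The space of vector-valued polynomial functions. -/
def polyFun : Submodule ℂ ((ι → ℂ) → V) := LinearMap.range (polyEmb ι V)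

theorem divMon_smul_mem_polyFun (k : ι → ℕ) (v : V) :
    (fun α => divMon α k • v) ∈ polyFun ι V :=
  ⟨Finsupp.single k v, polyEmb_single k v⟩

theorem const_mem_polyFun (v : V) : (fun _ => v) ∈ polyFun ι V := by
  simpa [divMon] using divMon_smul_mem_polyFun (ι := ι) 0 v

theorem coord_smul_mem_polyFun (i : ι) {F : (ι → ℂ) → V} (hF : F ∈ polyFun ι V) :
    (fun α => α i • F α) ∈ polyFun ι V := by
  obtain ⟨f, rfl⟩ := hF
  induction f using Finsupp.induction_linear with
  | zero =>
    simp only [map_zero, Pi.zero_apply, smul_zero]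
    exact (polyFun ι V).zero_mem
  | add f g hf hg =>
    simp only [map_add, Pi.add_apply, smul_add]
    exact (polyFun ι V).add_mem hf hg
  | single k v =>
    rw [polyEmb_single]
    simp only [smul_smul, mul_divMon]
    simp only [smul_assoc]
    exact (polyFun ι V).smul_mem _ (divMon_smul_mem_polyFun _ v)

theorem polyFun_induction {P : ((ι → ℂ) → V) → Prop} (hconst : ∀ v, P fun _ => v)
    (hcoord : ∀ i F, F ∈ polyFun ι V → P F → P fun α => α i • F α)
    (hadd : ∀ F G, F ∈ polyFun ι V → G ∈ polyFun ι V → P F → P G → P fun α => F α + G α)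
    {F : (ι → ℂ) → V} (hF : F ∈ polyFun ι V) : P F := by
  obtain ⟨f, rfl⟩ := hF
  induction f using Finsupp.induction_linear with
  | zero => exact (map_zero (polyEmb ι V)).symm ▸ hconst 0
  | add f g hf hg =>
    rw [map_add]
    exact hadd _ _ ⟨f, rfl⟩ ⟨g, rfl⟩ hf hg
  | single k v =>
    rw [polyEmb_single]
    have key : ∀ (t : Finset ι) (u : V), (fun α : ι → ℂ => (∏ i ∈ t, α i ^ k i) • u) ∈ polyFun ι V ∧
        P fun α => (∏ i ∈ t, α i ^ k i) • u := by
      intro t u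
      induction t using Finset.induction_on with
      | empty => simpa using ⟨const_mem_polyFun u, hconst u⟩
      | insert i t hi ih =>
        simp only [prod_insert hi]
        generalize k i = n
        induction n with
        | zero => simpa using ih
        | succ n ihn =>
          have h : ∀ α : ι → ℂ, (α i ^ (n + 1) * ∏ j ∈ t, α j ^ k j) • u
              = α i • ((α i ^ n * ∏ j ∈ t, α j ^ k j) • u) := fun α => by
            rw [smul_smul]; ring_nf
          simp only [h]
          exact ⟨coord_smul_mem_polyFun i ihn.1, hcoord i _ ihn.1 ihn.2⟩
    have h : (fun α : ι → ℂ => divMon α k • v)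
        = fun α => (∏ i, α i ^ k i) • ((∏ i, ((k i).factorial : ℂ)⁻¹) • v) := by
      funext α
      simp only [divMon, divPow, smul_eq_mul, prod_mul_distrib, smul_smul]
      rw [mul_comm]
    rw [h]
    exact (key univ _).2

/-- Composing a polynomial function with a linear map. -/
theorem map_mem_polyFun {W : Type*} [AddCommGroup W] [Module ℂ W] (L : V →ₗ[ℂ] W)
    {F : (ι → ℂ) → V} (hF : F ∈ polyFun ι V) : (fun α => L (F α)) ∈ polyFun ι W := by
  refine polyFun_induction (P := fun F => (fun α => L (F α)) ∈ polyFun ι W)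
    (fun v => const_mem_polyFun _) (fun i F _ h => ?_) (fun F G _ _ hF hG => ?_) hF
  · simpa using coord_smul_mem_polyFun i h
  · simp only [map_add]
    exact (polyFun ι W).add_mem hF hG

variable (ι V) in
/-- The scalar functions that preserve the space of polynomial functions. -/
def polyMultiplier : Subalgebra ℂ ((ι → ℂ) → ℂ) where
  carrier := {f | ∀ F ∈ polyFun ι V, (fun α => f α • F α) ∈ polyFun ι V}
  mul_mem' {f g} hf hg F hF := by simpa [mul_smul] using hf _ (hg F hF)
  add_mem' {f g} hf hg F hF := by
    simp only [Pi.add_apply, add_smul]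
    exact (polyFun ι V).add_mem (hf F hF) (hg F hF)
  algebraMap_mem' c F hF := (polyFun ι V).smul_mem c hF

theorem coord_mem_polyMultiplier (i : ι) : (fun α => α i) ∈ polyMultiplier ι V :=
  fun _ hF => coord_smul_mem_polyFun i hF

theorem divMon_mem_polyMultiplier {κ : Type*} [Fintype κ] {f : κ → (ι → ℂ) → ℂ}
    (hf : ∀ i, f i ∈ polyMultiplier ι V) (k : κ → ℕ) :
    (fun α => divMon (fun i => f i α) k) ∈ polyMultiplier ι V := by
  have h : (fun α => divMon (fun i => f i α) k) = ∏ i, divPow (f i) (k i) := by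
    funext α
    simp [divMon, divPow, Finset.prod_apply]
  rw [h]
  exact Subalgebra.prod_mem _ fun i _ => Subalgebra.smul_mem _ (Subalgebra.pow_mem _ (hf i) _) _

variable (ι V) in
/-- A linear retraction of all functions onto the coefficients of polynomial functions. -/
def polyCoeff : ((ι → ℂ) → V) →ₗ[ℂ] ((ι → ℕ) →₀ V) :=
  ((polyEmb ι V).exists_leftInverse_of_injective ker_polyEmb).choose

theorem polyCoeff_polyEmb (f : (ι → ℕ) →₀ V) : polyCoeff ι V (polyEmb ι V f) = f :=
  LinearMap.congr_fun ((polyEmb ι V).exists_leftInverse_of_injective ker_polyEmb).choose_spec f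

/-- The map sending a polynomial function `F`, regarded as a differential operator in `∂ₜ`'s, to
`F(∂_{t_1}, …, ∂_{t_n})` applied to the Laurent monomial with exponent `s` and restricted to the
diagonal `t_1 = ⋯ = t_n = t`. -/
def laurentEval (s : ι → ℤ) : ((ι → ℂ) → V) →ₗ[ℂ] (ℤ →₀ V) :=
  (Finsupp.lsum ℂ fun k : ι → ℕ =>
    (∏ i, genChoose (s i) (k i)) • Finsupp.lsingle (∑ i, s i - ∑ i, (k i : ℤ))) ∘ₗ polyCoeff ι V

theorem laurentEval_divMon (s : ι → ℤ) (k : ι → ℕ) (v : V) :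
    laurentEval s (fun α => divMon α k • v)
      = (∏ i, genChoose (s i) (k i)) • Finsupp.single (∑ i, s i - ∑ i, (k i : ℤ)) v := by
  rw [← polyEmb_single, laurentEval, LinearMap.comp_apply, polyCoeff_polyEmb]
  simp

@[simp] theorem genChoose_zero (z : ℤ) : genChoose z 0 = 1 := by simp [genChoose]

theorem genChoose_succ (z : ℤ) (k : ℕ) :
    ((k + 1 : ℕ) : ℂ) * genChoose z (k + 1) = (z : ℂ) * genChoose (z - 1) k := by
  have h : ((k + 1 : ℕ) : ℂ) ≠ 0 := Nat.cast_ne_zero.2 k.succ_ne_zero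
  have h' : (k.factorial : ℂ) ≠ 0 := Nat.cast_ne_zero.2 (Nat.factorial_ne_zero _)
  have hp : ∀ i : ℕ, (z : ℂ) - ((i + 1 : ℕ) : ℂ) = ((z - 1 : ℤ) : ℂ) - (i : ℂ) := fun i => by
    push_cast; ring
  rw [genChoose, genChoose, prod_range_succ', Nat.factorial_succ, Nat.cast_mul]
  simp only [hp]
  field_simp
  simp

theorem laurentEval_const (s : ι → ℤ) (v : V) :
    laurentEval s (fun _ => v) = Finsupp.single (∑ i, s i) v := by
  simpa [divMon] using laurentEval_divMon s 0 v

theorem laurentEval_coord (s : ι → ℤ) (i : ι) {F : (ι → ℂ) → V} (hF : F ∈ polyFun ι V) :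
    laurentEval s (fun α => α i • F α) = (s i : ℂ) • laurentEval (s - Pi.single i 1) F := by
  obtain ⟨f, rfl⟩ := hF
  induction f using Finsupp.induction_linear with
  | zero =>
    simp only [map_zero, Pi.zero_apply, smul_zero]
    exact map_zero _
  | add f g hf hg =>
    simp only [map_add, Pi.add_apply, smul_add]
    rw [← hf, ← hg, ← map_add]
    rfl
  | single k v =>
    rw [polyEmb_single]
    simp only [smul_smul, mul_divMon]
    simp only [smul_assoc]
    have h : (fun α : ι → ℂ => ((k i + 1 : ℕ) : ℂ) • divMon α (Function.update k i (k i + 1)) • v)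
        = ((k i + 1 : ℕ) : ℂ) • fun α : ι → ℂ => divMon α (Function.update k i (k i + 1)) • v := rfl
    rw [h, map_smul, laurentEval_divMon, laurentEval_divMon, smul_smul, smul_smul]
    congr 1
    · refine (congrArg _ (mul_prod_erase univ _ (mem_univ i)).symm).trans
        (Eq.trans ?_ (congrArg _ (mul_prod_erase univ _ (mem_univ i))))
      rw [← mul_assoc, ← mul_assoc, Function.update_self, genChoose_succ]
      congr 1
      · simp
      · refine prod_congr rfl fun j hj => ?_
        have hj := ne_of_mem_erase hj
        simp [hj]
    · congr 1
      have hk : ∑ x, ((Function.update k i (k i + 1) x : ℕ) : ℤ) = ∑ x, (k x : ℤ) + 1 := by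
        rw [← Nat.cast_sum, ← Nat.cast_sum, sum_update_of_mem (mem_univ i),
          sum_eq_add_sum_sdiff_singleton_of_mem (mem_univ i) k]
        push_cast
        ring
      simp only [hk, Pi.sub_apply, sum_sub_distrib, sum_pi_single', mem_univ, if_true]
      ring

/-- The sum of the entries of a family over the fibers of a map. -/
def fiberSum {κ A : Type*} [DecidableEq κ] [AddCommMonoid A] (p : ι → κ) (f : ι → A) (k : κ) : A :=
  ∑ j, if p j = k then f j else 0

theorem fiberSum_sub_single {κ : Type*} [DecidableEq κ] (p : ι → κ) (s : ι → ℤ) (j : ι) :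
    fiberSum p (s - Pi.single j 1) = fiberSum p s - Pi.single (p j) 1 := by
  funext l
  have h : ∑ i, (if p i = l then (Pi.single j 1 : ι → ℤ) i else 0)
      = if p j = l then 1 else 0 := by
    rw [sum_eq_single j (fun i _ hi => by simp [hi]) (by simp)]
    simp
  have h' : (Pi.single (p j) 1 : κ → ℤ) l = if p j = l then 1 else 0 := by
    simp [Pi.single_apply, eq_comm]
  rw [Pi.sub_apply, h', ← h]
  simp only [fiberSum]
  rw [← sum_sub_distrib]
  refine sum_congr rfl fun i _ => ?_
  split_ifs <;> simp

/-- Leibniz rule: restricting to diagonals in two stages. -/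
theorem laurentEval_fiberSum {κ : Type*} [Fintype κ] [DecidableEq κ] (p : ι → κ) (s : ι → ℤ)
    {F : (κ → ℂ) → V} (hF : F ∈ polyFun κ V) :
    (fun γ : ι → ℂ => F (fiberSum p γ)) ∈ polyFun ι V ∧
      laurentEval s (fun γ => F (fiberSum p γ)) = laurentEval (fiberSum p s) F := by
  revert s
  refine polyFun_induction (P := fun F => ∀ s : ι → ℤ,
    (fun γ : ι → ℂ => F (fiberSum p γ)) ∈ polyFun ι V ∧
      laurentEval s (fun γ => F (fiberSum p γ)) = laurentEval (fiberSum p s) F) ?_ ?_ ?_ hF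
  · intro v s
    refine ⟨const_mem_polyFun v, ?_⟩
    rw [laurentEval_const, laurentEval_const]
    congr 1
    simp only [fiberSum]
    rw [sum_comm]
    simp
  · intro k F hF ih s
    have hmem := (ih 0).1
    have hj : ∀ j : ι, (fun γ : ι → ℂ => (if p j = k then γ j else 0) • F (fiberSum p γ))
        ∈ polyFun ι V := by
      intro j
      split_ifs
      · exact coord_smul_mem_polyFun j hmem
      · simp only [zero_smul]
        exact (polyFun ι V).zero_mem
    have he : (fun γ : ι → ℂ => fiberSum p γ k • F (fiberSum p γ))
        = ∑ j, fun γ : ι → ℂ => (if p j = k then γ j else 0) • F (fiberSum p γ) := by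
      funext γ
      rw [Finset.sum_apply, ← sum_smul]
      rfl
    rw [he, map_sum]
    refine ⟨Submodule.sum_mem _ fun j _ => hj j, ?_⟩
    rw [laurentEval_coord _ _ hF]
    have hs : ((fiberSum p s k : ℤ) : ℂ) = ∑ j, if p j = k then (s j : ℂ) else 0 := by
      simp only [fiberSum]
      push_cast
      rfl
    rw [hs, sum_smul]
    refine sum_congr rfl fun j _ => ?_
    split_ifs with h
    · rw [laurentEval_coord _ _ hmem, (ih _).2]
      rw [fiberSum_sub_single, h]
    · simp only [zero_smul]
      exact map_zero _
  · intro F G hF hG ihF ihG s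
    refine ⟨(polyFun ι V).add_mem (ihF s).1 (ihG s).1, ?_⟩
    exact (map_add (laurentEval s) (fun γ => F (fiberSum p γ)) (fun γ => G (fiberSum p γ))).trans
      (by rw [(ihF s).2, (ihG s).2]; exact (map_add _ F G).symm)

end PolynomialFunctions

section Multiadditive

variable {ι κ : Type*} [Fintype ι] [DecidableEq ι] {V W : Type*} [AddCommGroup V] [Module ℂ V]
  [AddCommGroup W] [Module ℂ W]

/-- A property of families of Laurent polynomials that is additive in each variable holds as soon as
it holds for families of monomials. -/
theorem laurent_induction {P : (ι → (ℤ →₀ V)) → Prop}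
    (hadd : ∀ x i u v, P (Function.update x i u) → P (Function.update x i v) →
      P (Function.update x i (u + v)))
    (hs : ∀ (s : ι → ℤ) (a : ι → V), P fun i => Finsupp.single (s i) (a i)) (x) : P x := by
  have key : ∀ (t : Finset ι) (x : ι → (ℤ →₀ V)),
      (∀ i ∉ t, ∃ s a, x i = Finsupp.single s a) → P x := by
    intro t
    induction t using Finset.induction_on with
    | empty =>
      intro x hx
      choose s a hsa using fun i => hx i (notMem_empty i)
      exact (funext hsa : x = _) ▸ hs s a
    | insert i t hi ih =>
      intro x hx
      have hsingle : ∀ s a, P (Function.update x i (Finsupp.single s a)) := fun s a => by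
        refine ih _ fun j hj => ?_
        by_cases hji : j = i
        · subst hji
          exact ⟨s, a, by simp⟩
        · rw [Function.update_of_ne hji]
          exact hx j (by simp [hji, hj])
      have h : ∀ w, P (Function.update x i w) := fun w => by
        induction w using Finsupp.induction_linear with
        | zero => simpa using hsingle 0 0
        | add f g hf hg => exact hadd _ _ _ _ hf hg
        | single s a => exact hsingle s a
      simpa using h (x i)
  exact key univ x (by simp)

/-- Additivity in each variable. -/
def Multiadditive (T : (ι → V) → W) : Prop :=
  ∀ x i u v, T (Function.update x i (u + v))
    = T (Function.update x i u) + T (Function.update x i v)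

theorem Multiadditive.ext {T T' : (ι → (ℤ →₀ V)) → W} (hT : Multiadditive T)
    (hT' : Multiadditive T')
    (h : ∀ (s : ι → ℤ) (a : ι → V), T (fun i => Finsupp.single (s i) (a i))
      = T' fun i => Finsupp.single (s i) (a i)) (x) : T x = T' x :=
  laurent_induction (P := fun x => T x = T' x)
    (fun x i u v hu hv => by rw [hT, hT', hu, hv]) h x

theorem Multiadditive.map {U : Type*} [AddCommGroup U] [Module ℂ U] (L : W →ₗ[ℂ] U)
    {T : (ι → V) → W} (hT : Multiadditive T) : Multiadditive fun x => L (T x) :=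
  fun x i u v => by simp only [hT x i u v, map_add]

theorem Multiadditive.smul (c : ℂ) {T : (ι → V) → W} (hT : Multiadditive T) :
    Multiadditive fun x => c • T x := hT.map (LinearMap.lsmul ℂ W c)

theorem Multiadditive.neg {T : (ι → V) → W} (hT : Multiadditive T) :
    Multiadditive fun x => - T x := hT.map (-LinearMap.id)

theorem Multiadditive.add {T T' : (ι → V) → W} (hT : Multiadditive T) (hT' : Multiadditive T') :
    Multiadditive fun x => T x + T' x :=
  fun x i u v => by simp only [hT x i u v, hT' x i u v]; abel

theorem Multiadditive.sum {η : Type*} (t : Finset η) {T : η → (ι → V) → W}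
    (hT : ∀ e, Multiadditive (T e)) : Multiadditive fun x => ∑ e ∈ t, T e x :=
  fun x i u v => by simp only [hT _ x i u v, sum_add_distrib]

/-- Substitution into a multiadditive map of arguments such that each variable occurs in exactly one
of them, where it occurs additively. -/
theorem Multiadditive.comp [DecidableEq κ] {f : (κ → V) → W} (hf : Multiadditive f)
    (y : (ι → V) → κ → V)
    (hy : ∀ i, ∃ c, (∀ x w c', c' ≠ c → y (Function.update x i w) c' = y x c') ∧
      ∀ x u v, y (Function.update x i (u + v)) c
        = y (Function.update x i u) c + y (Function.update x i v) c) :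
    Multiadditive fun x => f (y x) := by
  intro x i u v
  obtain ⟨c, hc, hadd⟩ := hy i
  have h : ∀ w, y (Function.update x i w) = Function.update (y x) c (y (Function.update x i w) c) :=
    fun w => by
      funext c'
      by_cases hcc : c' = c
      · subst hcc; simp
      · rw [Function.update_of_ne hcc, hc _ _ _ hcc]
  calc f (y (Function.update x i (u + v)))
      = f (Function.update (y x) c (y (Function.update x i u) c + y (Function.update x i v) c)) :=
        congrArg f ((h _).trans (by rw [hadd]))
    _ = _ := (hf _ _ _ _).trans (congrArg₂ (fun a b => f a + f b) (h u).symm (h v).symm)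

theorem MultilinearMap.multiadditive (f : MultilinearMap ℂ (fun _ : ι => V) W) :
    Multiadditive f := fun x i u v => f.map_update_add x i u v

end Multiadditive

section Brackets

variable {m : ℕ} {V : Type*} [AddCommGroup V] [Module ℂ V]

/-- A pointwise finite sum of multilinear maps. -/
def finsumMultilinear {ι K W : Type*} [AddCommGroup W] [Module ℂ W]
    (f : K → MultilinearMap ℂ (fun _ : ι => V) W)
    (hf : ∀ x, (Function.support fun k => f k x).Finite) :
    MultilinearMap ℂ (fun _ : ι => V) W where
  toFun x := ∑ᶠ k, f k x
  map_update_add' x i u v := by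
    simp only [MultilinearMap.map_update_add]
    exact finsum_add_distrib (hf _) (hf _)
  map_update_smul' x i c u := by
    simp only [MultilinearMap.map_update_smul]
    exact (smul_finsum' c (hf _)).symm

/-- Local finiteness of a family of products. -/
def ProductsLocallyFinite
    (prodl : (Fin m → ℕ) → MultilinearMap ℂ (fun _ : Fin (m + 1) => V) V) : Prop :=
  ∀ x, ∃ N, VanishesFrom (fun k => prodl k x) N

open Polynomial in
/-- The bracket in which the weights are polynomials in the operator `D`. -/
def opEval (D : Module.End ℂ V)
    (prodl : (Fin m → ℕ) → MultilinearMap ℂ (fun _ : Fin (m + 1) => V) V)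
    (z : Fin m → ℂ[X]) (x : Fin (m + 1) → V) : V :=
  ∑ᶠ k, aeval D (divMon z k) (prodl k x)

variable {D : Module.End ℂ V}
  {prodl : (Fin m → ℕ) → MultilinearMap ℂ (fun _ : Fin (m + 1) => V) V}

theorem pEval_eq_finsum_divMon (prodl : (Fin m → ℕ) → MultilinearMap ℂ (fun _ : Fin (m + 1) => V) V)
    (lam : Fin m → ℂ) (x : Fin (m + 1) → V) :
    pEval prodl lam x = ∑ᶠ k, divMon lam k • prodl k x := by
  simp only [pEval, dPow_eq_divPow, divMon]

theorem pEval_eq_opEval (D : Module.End ℂ V)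
    (prodl : (Fin m → ℕ) → MultilinearMap ℂ (fun _ : Fin (m + 1) => V) V)
    (lam : Fin m → ℂ) (x : Fin (m + 1) → V) :
    pEval prodl lam x = opEval D prodl (fun i => Polynomial.C (lam i)) x := by
  rw [pEval_eq_finsum_divMon, opEval]
  refine finsum_congr fun k => ?_
  have h : divMon (fun i => Polynomial.C (lam i)) k = Polynomial.C (divMon lam k) :=
    (map_divMon (Polynomial.CAlgHom (R := ℂ) (A := ℂ)) lam k).symm
  rw [h, Polynomial.aeval_C, Module.algebraMap_end_apply]

theorem pEvalOp_eq_opEval [NeZero m] (D : Module.End ℂ V)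
    (prodl : (Fin m → ℕ) → MultilinearMap ℂ (fun _ : Fin (m + 1) => V) V)
    (lam : Fin m → ℂ) (c : ℂ) (x : Fin (m + 1) → V) :
    pEvalOp D prodl lam c x = opEval D prodl (Function.update (fun i => Polynomial.C (lam i))
      (lastIdx m) (-(Polynomial.X + Polynomial.C c))) x := by
  rw [pEvalOp, opEval]
  refine finsum_congr fun k => ?_
  have h : ∏ s ∈ univ.erase (lastIdx m), divPow (Function.update (fun i => Polynomial.C (lam i))
      (lastIdx m) (-(Polynomial.X + Polynomial.C c)) s) (k s)
      = Polynomial.C (∏ s ∈ univ.erase (lastIdx m), divPow (lam s) (k s)) := by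
    rw [map_prod]
    refine prod_congr rfl fun i hi => ?_
    rw [Function.update_of_ne (ne_of_mem_erase hi)]
    exact (map_divPow (Polynomial.CAlgHom (R := ℂ) (A := ℂ)) (lam i) (k i)).symm
  rw [divMon, ← mul_prod_erase univ _ (mem_univ (lastIdx m)), h, mul_comm, map_mul,
    Polynomial.aeval_C, Module.End.mul_apply, Module.algebraMap_end_apply, Function.update_self]
  simp only [dPow_eq_divPow]
  congr 1
  rw [divPow, map_smul, map_pow, map_neg, map_add, Polynomial.aeval_X, Polynomial.aeval_C,
    LinearMap.smul_apply, Algebra.algebraMap_eq_smul_one]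

/-- The bracket with operator weights as a multilinear map. -/
def opEvalMultilinear (D : Module.End ℂ V) (h : ProductsLocallyFinite prodl)
    (z : Fin m → Polynomial ℂ) : MultilinearMap ℂ (fun _ : Fin (m + 1) => V) V :=
  finsumMultilinear
    (fun k => (Polynomial.aeval D (divMon z k) : V →ₗ[ℂ] V).compMultilinearMap (prodl k)) fun x =>
    have ⟨_, hN⟩ := h x
    (hN.map fun k => (Polynomial.aeval D (divMon z k)).toAddMonoidHom).finite_support

theorem opEvalMultilinear_apply (h : ProductsLocallyFinite prodl) (z : Fin m → Polynomial ℂ)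
    (x : Fin (m + 1) → V) : opEvalMultilinear D h z x = opEval D prodl z x := rfl

theorem exists_multilinearMap_eq_pEval (h : ProductsLocallyFinite prodl) (lam : Fin m → ℂ) :
    ∃ f : MultilinearMap ℂ (fun _ : Fin (m + 1) => V) V, ∀ x, f x = pEval prodl lam x :=
  ⟨opEvalMultilinear 0 h fun i => Polynomial.C (lam i),
    fun x => (pEval_eq_opEval 0 prodl lam x).symm⟩

theorem opEval_add (h : ProductsLocallyFinite prodl) (z w : Fin m → Polynomial ℂ)
    (x : Fin (m + 1) → V) : opEval D prodl (z + w) x = ∑ᶠ k, ∑ᶠ j,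
      Polynomial.aeval D (divMon z k * divMon w j) (prodl (k + j) x) := by
  obtain ⟨N, hN⟩ := h x
  exact finsum_divMon_add
    (AddMonoidHom.mk' (fun p => (Polynomial.aeval D p).toAddMonoidHom) fun p q => by
      ext; simp) z w hN

end Brackets

section Affinization

variable {m : ℕ} {V : Type*} [AddCommGroup V] [Module ℂ V]

/-- The operator `D ⊗ 1 + 1 ⊗ ∂ₜ` on Laurent polynomials. -/
def laurentD (D : Module.End ℂ V) : Module.End ℂ (ℤ →₀ V) :=
  Finsupp.lsum ℂ (fun s : ℤ =>
    Finsupp.lsingle s ∘ₗ (D : V →ₗ[ℂ] V) + ((s : ℂ)) • Finsupp.lsingle (s - 1))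

theorem laurentD_single (D : Module.End ℂ V) (s : ℤ) (v : V) :
    laurentD D (Finsupp.single s v)
      = Finsupp.single s (D v) + (s : ℂ) • Finsupp.single (s - 1) v := by
  simp [laurentD]

variable {ι : Type*} [Fintype ι] [DecidableEq ι]

theorem sum_coord_smul_mem_polyFun {F : (ι → ℂ) → V} (hF : F ∈ polyFun ι V) :
    (fun α => (∑ i, α i) • F α) ∈ polyFun ι V := by
  simp only [sum_smul]
  have h := Submodule.sum_mem (polyFun ι V) (t := univ)
    (f := fun i => fun α : ι → ℂ => α i • F α) fun i _ => coord_smul_mem_polyFun i hF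
  convert h using 1
  ext α
  simp

theorem laurentEval_add (s : ι → ℤ) (F G : (ι → ℂ) → V) :
    laurentEval s (fun α => F α + G α) = laurentEval s F + laurentEval s G :=
  map_add (laurentEval s) F G

theorem laurentEval_smul (s : ι → ℤ) (c : ℂ) (F : (ι → ℂ) → V) :
    laurentEval s (fun α => c • F α) = c • laurentEval s F :=
  map_smul (laurentEval s) c F

theorem laurentEval_neg (s : ι → ℤ) (F : (ι → ℂ) → V) :
    laurentEval s (fun α => - F α) = - laurentEval s F :=
  map_neg (laurentEval s) F

theorem laurentEval_sum {η : Type*} (t : Finset η) (s : ι → ℤ) (F : η → (ι → ℂ) → V) :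
    laurentEval s (fun α => ∑ e ∈ t, F e α) = ∑ e ∈ t, laurentEval s (F e) := by
  rw [← map_sum]
  congr 1
  ext α
  simp

theorem laurentEval_sum_coord (s : ι → ℤ) {F : (ι → ℂ) → V} (hF : F ∈ polyFun ι V) :
    laurentEval s (fun α => (∑ i, α i) • F α)
      = ∑ i, (s i : ℂ) • laurentEval (s - Pi.single i 1) F := by
  simp only [sum_smul, laurentEval_sum, laurentEval_coord _ _ hF]

theorem laurentD_laurentEval (D : Module.End ℂ V) (s : ι → ℤ) {F : (ι → ℂ) → V}
    (hF : F ∈ polyFun ι V) :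
    laurentD D (laurentEval s F) = laurentEval s fun α => D (F α) + (∑ i, α i) • F α := by
  revert s
  refine polyFun_induction (P := fun F => ∀ s : ι → ℤ, laurentD D (laurentEval s F)
    = laurentEval s fun α => D (F α) + (∑ i, α i) • F α) ?_ ?_ ?_ hF
  · intro v s
    rw [laurentEval_add, laurentEval_const, laurentEval_const, laurentD_single,
      laurentEval_sum_coord _ (const_mem_polyFun v)]
    simp only [laurentEval_const, Pi.sub_apply, sum_sub_distrib, sum_pi_single', mem_univ, if_true,
      ← sum_smul, Int.cast_sum]
  · intro i F hF ih s
    have h : (fun α : ι → ℂ => D (α i • F α) + (∑ i, α i) • α i • F α)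
        = fun α => α i • (D (F α) + (∑ i, α i) • F α) := by
      funext α
      rw [map_smul, smul_add, smul_comm]
    rw [laurentEval_coord _ _ hF, map_smul, ih, h, laurentEval_coord]
    exact (polyFun ι V).add_mem (map_mem_polyFun D hF) (sum_coord_smul_mem_polyFun hF)
  · intro F G hF hG ihF ihG s
    have h : (fun α : ι → ℂ => D (F α + G α) + (∑ i, α i) • (F α + G α))
        = fun α => (D (F α) + (∑ i, α i) • F α) + (D (G α) + (∑ i, α i) • G α) := by
      funext α
      rw [map_add, smul_add]
      abel
    rw [h, laurentEval_add, laurentEval_add, map_add, ihF, ihG]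

open Polynomial in
theorem aeval_laurentD_laurentEval (D : Module.End ℂ V) (s : ι → ℤ) (p : ℂ[X]) {F : (ι → ℂ) → V}
    (hF : F ∈ polyFun ι V) :
    aeval (laurentD D) p (laurentEval s F)
      = laurentEval s fun α => aeval D (p.comp (X + C (∑ i, α i))) (F α) := by
  induction p using Polynomial.induction_on' generalizing F with
  | add p q hp hq =>
    simp only [map_add, LinearMap.add_apply, add_comp, hp hF, hq hF, laurentEval_add]
  | monomial n a =>
    induction n generalizing F with
    | zero => simp [laurentEval_smul, Module.algebraMap_end_apply]
    | succ n ih =>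
      have hmem : (fun α => D (F α) + (∑ i, α i) • F α) ∈ polyFun ι V :=
        (polyFun ι V).add_mem (map_mem_polyFun D hF) (sum_coord_smul_mem_polyFun hF)
      rw [← monomial_mul_X, map_mul, aeval_X, Module.End.mul_apply, laurentD_laurentEval D s hF,
        ih hmem]
      congr 1
      funext α
      have h : aeval D (X + C (∑ i, α i)) (F α) = D (F α) + (∑ i, α i) • F α := by
        rw [map_add, aeval_X, aeval_C, LinearMap.add_apply, Module.algebraMap_end_apply]
      rw [mul_comp, X_comp, map_mul, Module.End.mul_apply, h]

variable {prodl : (Fin m → ℕ) → MultilinearMap ℂ (fun _ : Fin (m + 1) => V) V}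

/-- The coefficient of the products on the affinization at given exponents. -/
def affCoeff (h : ProductsLocallyFinite prodl) (k : Fin m → ℕ) (s : Fin (m + 1) → ℤ) :
    MultilinearMap ℂ (fun _ : Fin (m + 1) => V) (ℤ →₀ V) :=
  finsumMultilinear (fun j : Fin m → ℕ => (∏ i : Fin m, genChoose (s i.castSucc) (j i)) •
    (Finsupp.lsingle (∑ i, s i - ∑ i, (j i : ℤ)) : V →ₗ[ℂ] (ℤ →₀ V)).compMultilinearMap
      (prodl (fun i => k i + j i))) fun x =>
    have ⟨_, hN⟩ := h x
    (((hN.shift k).map fun j => ((∏ i : Fin m, genChoose (s i.castSucc) (j i)) •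
      (Finsupp.lsingle (∑ i, s i - ∑ i, (j i : ℤ)) : V →ₗ[ℂ] (ℤ →₀ V))).toAddMonoidHom)
      ).finite_support

open Classical in
/-- The products on the affinization. -/
def affProd (h : ProductsLocallyFinite prodl) (k : Fin m → ℕ) :
    MultilinearMap ℂ (fun _ : Fin (m + 1) => ℤ →₀ V) (ℤ →₀ V) :=
  (MultilinearMap.fromDFinsuppEquiv (fun _ : Fin (m + 1) => ℤ) ℂ
    (M := fun _ _ => V) (affCoeff h k)).compLinearMap
    fun _ => (finsuppLequivDFinsupp (M := V) ℂ).toLinearMap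

theorem affProd_single (h : ProductsLocallyFinite prodl) (k : Fin m → ℕ) (s : Fin (m + 1) → ℤ)
    (a : Fin (m + 1) → V) :
    affProd h k (fun i => Finsupp.single (s i) (a i))
      = ∑ᶠ j : Fin m → ℕ, (∏ i : Fin m, genChoose (s i.castSucc) (j i)) •
          Finsupp.single (∑ i, s i - ∑ i, (j i : ℤ)) (prodl (fun i => k i + j i) a) := by
  rw [affProd, MultilinearMap.compLinearMap_apply]
  simp only [LinearEquiv.coe_coe, finsuppLequivDFinsupp_apply_apply, Finsupp.toDFinsupp_single]
  rw [MultilinearMap.fromDFinsuppEquiv_single]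
  rfl

theorem VanishesFrom.divMon_castSucc_mem_polyFun {g : (Fin m → ℕ) → V} {N : ℕ}
    (hg : VanishesFrom g N) :
    (fun α : Fin (m + 1) → ℂ => ∑ᶠ j, divMon (fun i : Fin m => α i.castSucc) j • g j)
      ∈ polyFun (Fin (m + 1)) V ∧
    ∀ s : Fin (m + 1) → ℤ,
      laurentEval s (fun α => ∑ᶠ j, divMon (fun i : Fin m => α i.castSucc) j • g j)
        = ∑ᶠ j : Fin m → ℕ, (∏ i : Fin m, genChoose (s i.castSucc) (j i)) •
          Finsupp.single (∑ i, s i - ∑ i, (j i : ℤ)) (g j) := by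
  have hsnoc : ∀ (α : Fin (m + 1) → ℂ) (j : Fin m → ℕ), divMon (fun i : Fin m => α i.castSucc) j
      = divMon α (Fin.snoc (α := fun _ => ℕ) j 0) := fun α j => by
    simp [divMon, Fin.prod_univ_castSucc]
  have hfin : ∀ α : Fin (m + 1) → ℂ, ∑ᶠ j, divMon (fun i : Fin m => α i.castSucc) j • g j
      = ∑ j ∈ multiBox (Fin m) N, divMon α (Fin.snoc (α := fun _ => ℕ) j 0) • g j := fun α => by
    simp only [hsnoc]
    exact (hg.map fun j => (divMon α (Fin.snoc (α := fun _ => ℕ) j 0) •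
      (LinearMap.id : V →ₗ[ℂ] V)).toAddMonoidHom).finsum_eq
  simp only [hfin]
  constructor
  · have h := Submodule.sum_mem (polyFun (Fin (m + 1)) V) (t := multiBox (Fin m) N)
      (f := fun j => fun α : Fin (m + 1) → ℂ => divMon α (Fin.snoc (α := fun _ => ℕ) j 0) • g j)
      fun j _ => divMon_smul_mem_polyFun _ _
    convert h using 1
    ext α
    simp
  · intro s
    refine ((laurentEval_sum _ _ _).trans (sum_congr rfl fun j _ => ?_)).trans
      (hg.map fun j => ((∏ i : Fin m, genChoose (s i.castSucc) (j i)) •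
      (Finsupp.lsingle (∑ i, s i - ∑ i, (j i : ℤ)) : V →ₗ[ℂ] (ℤ →₀ V))).toAddMonoidHom
      ).finsum_eq.symm
    rw [laurentEval_divMon, Fin.prod_univ_castSucc (n := m), Fin.sum_univ_castSucc (n := m)
      (fun i => ((Fin.snoc (α := fun _ => ℕ) j 0 i : ℕ) : ℤ))]
    simp

theorem affProd_eq_laurentEval (h : ProductsLocallyFinite prodl) (k : Fin m → ℕ)
    (s : Fin (m + 1) → ℤ) (a : Fin (m + 1) → V) :
    (fun α : Fin (m + 1) → ℂ => ∑ᶠ j, divMon (fun i : Fin m => α i.castSucc) j • prodl (k + j) a)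
      ∈ polyFun (Fin (m + 1)) V ∧
    affProd h k (fun i => Finsupp.single (s i) (a i)) = laurentEval s
      fun α => ∑ᶠ j, divMon (fun i : Fin m => α i.castSucc) j • prodl (k + j) a := by
  obtain ⟨N, hN⟩ := h a
  have h' := (hN.shift k).divMon_castSucc_mem_polyFun
  exact ⟨h'.1, (affProd_single h k s a).trans (h'.2 s).symm⟩

theorem affProd_locallyFinite (h : ProductsLocallyFinite prodl) :
    ProductsLocallyFinite (affProd h) := by
  refine laurent_induction ?_ ?_
  · rintro x i u v ⟨N, hN⟩ ⟨N', hN'⟩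
    refine ⟨max N N', fun k hk => ?_⟩
    dsimp only
    rw [MultilinearMap.map_update_add]
    exact (congrArg₂ (· + ·) (hN k (le_of_max_le_left hk)) (hN' k (le_of_max_le_right hk))).trans
      (add_zero 0)
  · intro s a
    obtain ⟨N, hN⟩ := h a
    refine ⟨N, fun k hk => ?_⟩
    dsimp only
    rw [affProd_single]
    refine (finsum_congr fun j => ?_).trans finsum_zero
    have h0 : prodl (fun i => k i + j i) a = 0 := hN _ <| by
      rw [sum_add_distrib]
      omega
    rw [h0, Finsupp.single_zero, smul_zero]

open Polynomial in
theorem opEval_affProd_single (D : Module.End ℂ V) (h : ProductsLocallyFinite prodl)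
    (z : Fin m → ℂ[X]) (s : Fin (m + 1) → ℤ) (a : Fin (m + 1) → V) :
    opEval (laurentD D) (affProd h) z (fun i => Finsupp.single (s i) (a i))
      = laurentEval s fun α =>
        opEval D prodl (fun i => (z i).comp (X + C (∑ i, α i)) + C (α i.castSucc)) a := by
  obtain ⟨N, hN⟩ := h a
  obtain ⟨N', hN'⟩ := affProd_locallyFinite h fun i => Finsupp.single (s i) (a i)
  replace hN := hN.mono (le_max_left N N')
  replace hN' := hN'.mono (le_max_right N N')
  generalize max N N' = M at hN hN'
  have hR : ∀ α : Fin (m + 1) → ℂ,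
      opEval D prodl (fun i => (z i).comp (X + C (∑ i, α i)) + C (α i.castSucc)) a
        = ∑ k ∈ multiBox (Fin m) M, aeval D ((divMon z k).comp (X + C (∑ i, α i)))
          (∑ᶠ j, divMon (fun i : Fin m => α i.castSucc) j • prodl (k + j) a) := by
    intro α
    have hz : ∀ k, divMon (fun i => (z i).comp (X + C (∑ i, α i))) k
        = (divMon z k).comp (X + C (∑ i, α i)) := fun k =>
      (map_divMon (aeval (R := ℂ) (X + C (∑ i, α i))) z k).symm
    have hw : ∀ j, divMon (fun i : Fin m => C (α i.castSucc)) j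
        = C (divMon (fun i : Fin m => α i.castSucc) j) := fun j =>
      (map_divMon (CAlgHom (R := ℂ) (A := ℂ)) _ j).symm
    refine (opEval_add h (fun i => (z i).comp (X + C (∑ i, α i)))
      (fun i => C (α i.castSucc)) a).trans ?_
    have hj : ∀ k, ∑ᶠ j, aeval D ((divMon z k).comp (X + C (∑ i, α i)) *
        C (divMon (fun i : Fin m => α i.castSucc) j)) (prodl (k + j) a)
        = aeval D ((divMon z k).comp (X + C (∑ i, α i)))
          (∑ᶠ j, divMon (fun i : Fin m => α i.castSucc) j • prodl (k + j) a) := by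
      intro k
      have hv := (hN.shift k).map fun j => (divMon (fun i : Fin m => α i.castSucc) j •
        (LinearMap.id : V →ₗ[ℂ] V)).toAddMonoidHom
      refine Eq.trans ?_ ((aeval D ((divMon z k).comp (X + C (∑ i, α i)))).toAddMonoidHom.map_finsum
        hv.finite_support).symm
      refine finsum_congr fun j => ?_
      simp [Module.algebraMap_end_apply]
    simp only [hz, hw, hj]
    have hv : VanishesFrom (fun k => aeval D ((divMon z k).comp (X + C (∑ i, α i)))
        (∑ᶠ j, divMon (fun i : Fin m => α i.castSucc) j • prodl (k + j) a)) M := by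
      intro k hk
      dsimp only
      rw [finsum_congr (g := fun _ => (0 : V)) fun j => ?_, finsum_zero, map_zero]
      have h0 : prodl (k + j) a = 0 := hN _ <| by
        simp only [Pi.add_apply, sum_add_distrib]
        omega
      rw [h0, smul_zero]
    exact hv.finsum_eq
  simp only [hR, laurentEval_sum]
  refine (hN'.map fun k => (aeval (laurentD D) (divMon z k)).toAddMonoidHom).finsum_eq.trans
    (sum_congr rfl fun k _ => ?_)
  obtain ⟨hmem, he⟩ := affProd_eq_laurentEval h k s a
  refine (congrArg _ he).trans ?_
  exact aeval_laurentD_laurentEval D s _ hmem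

theorem pEval_affProd_single (h : ProductsLocallyFinite prodl) (lam : Fin m → ℂ)
    (s : Fin (m + 1) → ℤ) (a : Fin (m + 1) → V) :
    pEval (affProd h) lam (fun i => Finsupp.single (s i) (a i))
      = laurentEval s fun α => pEval prodl (fun i => lam i + α i.castSucc) a := by
  rw [pEval_eq_opEval (laurentD 0), opEval_affProd_single]
  simp only [pEval_eq_opEval 0 prodl, Polynomial.C_comp, Polynomial.C_add]

end Affinization

section Polynomiality

variable {m : ℕ} {V : Type*} [AddCommGroup V] [Module ℂ V]
  {prodl : (Fin m → ℕ) → MultilinearMap ℂ (fun _ : Fin (m + 1) => V) V}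
  {ι : Type*} [Fintype ι] [DecidableEq ι]

theorem pEval_mem_polyFun (h : ProductsLocallyFinite prodl) {w : Fin m → (ι → ℂ) → ℂ}
    (hw : ∀ t, w t ∈ polyMultiplier ι V) (a : Fin (m + 1) → V) :
    (fun α => pEval prodl (fun t => w t α) a) ∈ polyFun ι V := by
  obtain ⟨N, hN⟩ := h a
  have he : (fun α => pEval prodl (fun t => w t α) a)
      = ∑ k ∈ multiBox (Fin m) N, fun α => divMon (fun t => w t α) k • prodl k a := by
    funext α
    rw [Finset.sum_apply, pEval_eq_finsum_divMon]
    exact (hN.map fun k => (divMon (fun t => w t α) k •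
      (LinearMap.id : V →ₗ[ℂ] V)).toAddMonoidHom).finsum_eq
  rw [he]
  exact Submodule.sum_mem _ fun k _ => divMon_mem_polyMultiplier hw k _ (const_mem_polyFun _)

theorem const_mem_polyMultiplier (c : ℂ) : (fun _ => c) ∈ polyMultiplier ι V :=
  (polyMultiplier ι V).algebraMap_mem c

theorem pEval_add_coord_mem_polyFun (h : ProductsLocallyFinite prodl) (lam : Fin m → ℂ)
    (e : Fin m → ι) (a : Fin (m + 1) → V) :
    (fun α => pEval prodl (fun t => lam t + α (e t)) a) ∈ polyFun ι V :=
  pEval_mem_polyFun h (w := fun t α => lam t + α (e t))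
    (fun t => (polyMultiplier ι V).add_mem (const_mem_polyMultiplier _)
      (coord_mem_polyMultiplier (e t))) a

theorem laurentEval_comp_equiv (σ : Equiv.Perm ι) (s : ι → ℤ) {F : (ι → ℂ) → V}
    (hF : F ∈ polyFun ι V) :
    laurentEval (fun i => s (σ i)) F = laurentEval s fun γ => F fun i => γ (σ i) := by
  have h : ∀ {A : Type} [AddCommMonoid A] (f : ι → A),
      fiberSum σ.symm f = fun i => f (σ i) := by
    intro A _ f
    funext i
    simp only [fiberSum, Equiv.symm_apply_eq]
    simp
  have h2 := (laurentEval_fiberSum (σ.symm) s hF).2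
  simp only [h] at h2
  exact h2.symm

theorem update_single (s : ι → ℤ) (a : ι → V) (i : ι) (t : ℤ) (v : V) :
    Function.update (fun j => Finsupp.single (s j) (a j)) i (Finsupp.single t v)
      = fun j => Finsupp.single (Function.update s i t j) (Function.update a i v j) := by
  funext j
  by_cases hj : j = i
  · subst hj
    simp
  · simp [hj]

end Polynomiality

section Substitution

variable {ι κ : Type*} [Fintype ι] [DecidableEq ι] {V W : Type*} [AddCommGroup V] [Module ℂ V]
  [AddCommGroup W] [Module ℂ W]

theorem Multiadditive.comp_equiv {f : (ι → V) → W} (hf : Multiadditive f) (σ : Equiv.Perm ι) :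
    Multiadditive fun x => f fun i => x (σ i) := by
  refine hf.comp (fun x i => x (σ i)) fun i => ⟨σ.symm i, fun x w c hc => ?_, fun x u v => ?_⟩
  · rw [Function.update_of_ne]
    exact fun h => hc (by simp [← h])
  · simp

theorem Multiadditive.comp_update {f : (ι → V) → W} (hf : Multiadditive f) (L : V →ₗ[ℂ] V)
    (j : ι) : Multiadditive fun x => f (Function.update x j (L (x j))) := by
  refine hf.comp (fun x => Function.update x j (L (x j)))
    fun i => ⟨i, fun x w c hc => ?_, fun x u v => ?_⟩
  · by_cases hcj : c = j
    · subst hcj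
      simp [hc]
    · simp [hc, hcj]
  · by_cases hij : i = j
    · subst hij
      simp
    · simp [hij]

end Substitution

section Grafting

/-- The combinatorial data of an iterated bracket whose arguments are indexed by `J`: the inner
bracket, with arguments `inner`, is plugged into `slot` of the outer bracket, whose other arguments
are given by `outer`. The map `owner` records the slot of the outer bracket in which an argument
occurs. -/
structure Grafting (m : ℕ) (J : Type*) where
  slot : Fin (m + 1)
  outer : Fin (m + 1) → J
  inner : Fin (m + 1) → J
  owner : J → Fin (m + 1)
  inner_injective : Function.Injective inner
  owner_inner : ∀ k, owner (inner k) = slot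
  owner_outer : ∀ k, k ≠ slot → owner (outer k) = k
  exists_inner : ∀ j, owner j = slot → ∃ k, inner k = j
  outer_owner : ∀ j, owner j ≠ slot → outer (owner j) = j

variable {m : ℕ} {J : Type*} [Fintype J] [DecidableEq J]

namespace Grafting

variable (g : Grafting m J)

theorem fiberSum_owner_of_ne {A : Type*} [AddCommMonoid A] (f : J → A) {k : Fin (m + 1)}
    (hk : k ≠ g.slot) : fiberSum g.owner f k = f (g.outer k) := by
  rw [fiberSum, sum_eq_single (g.outer k) (fun j _ hj => ?_) (by simp), if_pos (g.owner_outer k hk)]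
  refine if_neg fun h => hj ?_
  rw [← h, g.outer_owner j (h ▸ hk)]

theorem fiberSum_owner_slot {A : Type*} [AddCommMonoid A] (f : J → A) :
    fiberSum g.owner f g.slot = ∑ k, f (g.inner k) := by
  rw [fiberSum, ← sum_filter]
  refine (sum_bij (fun k _ => g.inner k) (fun k _ => by simp [g.owner_inner])
    (fun a _ b _ h => g.inner_injective h) (fun j hj => ?_) fun _ _ => rfl).symm
  obtain ⟨k, hk⟩ := g.exists_inner j (mem_filter.1 hj).2
  exact ⟨k, mem_univ _, hk⟩

variable {V : Type*} [AddCommGroup V] [Module ℂ V]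
  {prodl : (Fin m → ℕ) → MultilinearMap ℂ (fun _ : Fin (m + 1) => V) V}

/-- The iterated bracket described by a grafting. -/
def nested (prodl : (Fin m → ℕ) → MultilinearMap ℂ (fun _ : Fin (m + 1) => V) V)
    (nu mu : Fin m → ℂ) (x : J → V) : V :=
  pEval prodl nu (Function.update (fun k => x (g.outer k)) g.slot
    (pEval prodl mu fun k => x (g.inner k)))

theorem nested_multiadditive (h : ProductsLocallyFinite prodl) (nu mu : Fin m → ℂ) :
    Multiadditive (g.nested prodl nu mu) := by
  obtain ⟨f, hf⟩ := exists_multilinearMap_eq_pEval h nu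
  obtain ⟨f', hf'⟩ := exists_multilinearMap_eq_pEval h mu
  have he : g.nested prodl nu mu = fun x => f (Function.update (fun k => x (g.outer k)) g.slot
      (f' fun k => x (g.inner k))) := by
    funext x
    rw [nested, ← hf', ← hf]
  rw [he]
  refine f.multiadditive.comp (fun x => Function.update (fun k => x (g.outer k)) g.slot
    (f' fun k => x (g.inner k))) fun j => ⟨g.owner j, fun x w c hc => ?_, fun x u v => ?_⟩
  · by_cases hcs : c = g.slot
    · subst hcs
      have hne : ∀ k, g.inner k ≠ j := fun k hk => hc (by rw [← hk, g.owner_inner])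
      simp [hne]
    · have hne : g.outer c ≠ j := fun hk => hc (by rw [← hk, g.owner_outer c hcs])
      simp [hcs, hne]
  · by_cases hj : g.owner j = g.slot
    · obtain ⟨k, rfl⟩ := g.exists_inner j hj
      have hu : ∀ u, (fun l => Function.update x (g.inner k) u (g.inner l))
          = Function.update (fun l => x (g.inner l)) k u :=
        fun u => Function.update_comp_eq_of_injective x g.inner_injective k u
      simp [hj, hu]
    · simp [hj, g.outer_owner j hj]

theorem pEval_update_laurentEval (h : ProductsLocallyFinite prodl) (nu : Fin m → ℂ) (a : J → V)
    {G : (Fin (m + 1) → ℂ) → V} (hG : G ∈ polyFun (Fin (m + 1)) V) (S : J → ℤ) :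
    (fun γ : J → ℂ => pEval prodl (fun t => nu t + fiberSum g.owner γ t.castSucc)
      (Function.update (fun k => a (g.outer k)) g.slot (G fun k => γ (g.inner k))))
        ∈ polyFun J V ∧
    pEval (affProd h) nu
      (Function.update (fun k => Finsupp.single (S (g.outer k)) (a (g.outer k))) g.slot
        (laurentEval (fun k => S (g.inner k)) G))
      = laurentEval S fun γ => pEval prodl (fun t => nu t + fiberSum g.owner γ t.castSucc)
        (Function.update (fun k => a (g.outer k)) g.slot (G fun k => γ (g.inner k))) := by
  obtain ⟨B, hB⟩ := exists_multilinearMap_eq_pEval (affProd_locallyFinite h) nu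
  choose f hf using fun lam => exists_multilinearMap_eq_pEval h lam
  simp only [← hB, ← hf]
  revert S
  refine polyFun_induction (P := fun G => ∀ S : J → ℤ,
    (fun γ : J → ℂ => f (fun t => nu t + fiberSum g.owner γ t.castSucc)
      (Function.update (fun k => a (g.outer k)) g.slot (G fun k => γ (g.inner k))))
        ∈ polyFun J V ∧
    B (Function.update (fun k => Finsupp.single (S (g.outer k)) (a (g.outer k))) g.slot
        (laurentEval (fun k => S (g.inner k)) G))
      = laurentEval S fun γ => f (fun t => nu t + fiberSum g.owner γ t.castSucc)
        (Function.update (fun k => a (g.outer k)) g.slot (G fun k => γ (g.inner k)))) ?_ ?_ ?_ hG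
  · intro v S
    have hs : Function.update (fun k => S (g.outer k)) g.slot (∑ k, S (g.inner k))
        = fiberSum g.owner S := by
      funext k
      by_cases hk : k = g.slot
      · subst hk
        rw [Function.update_self, g.fiberSum_owner_slot]
      · rw [Function.update_of_ne hk, g.fiberSum_owner_of_ne _ hk]
    have key := laurentEval_fiberSum g.owner S (pEval_add_coord_mem_polyFun h nu Fin.castSucc
      (Function.update (fun k => a (g.outer k)) g.slot v))
    simp only [← hf] at key
    refine ⟨key.1, ?_⟩
    rw [key.2, laurentEval_const, update_single (fun k => S (g.outer k)), hs, hB,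
      pEval_affProd_single]
    simp only [hf]
  · intro k F hF ih S
    have hS : (fun l => S (g.inner l)) - Pi.single k 1
        = fun l => (S - Pi.single (g.inner k) 1 : J → ℤ) (g.inner l) := by
      funext l
      simp [Pi.single_apply, g.inner_injective.eq_iff]
    have hS' : ∀ w : ℤ →₀ V,
        Function.update (fun k => Finsupp.single (S (g.outer k)) (a (g.outer k))) g.slot w
        = Function.update (fun l => Finsupp.single
          ((S - Pi.single (g.inner k) 1 : J → ℤ) (g.outer l)) (a (g.outer l))) g.slot w := by
      intro w
      funext l
      by_cases hl : l = g.slot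
      · subst hl; simp
      · have hne : g.outer l ≠ g.inner k := fun he => hl (by
          rw [← g.owner_outer l hl, he, g.owner_inner])
        simp [hl, hne]
    simp only [MultilinearMap.map_update_smul]
    refine ⟨coord_smul_mem_polyFun (g.inner k) (ih S).1, ?_⟩
    rw [laurentEval_coord _ _ hF, MultilinearMap.map_update_smul, hS, hS', (ih _).2,
      laurentEval_coord _ _ (ih S).1]
  · intro F G _ _ ihF ihG S
    simp only [MultilinearMap.map_update_add, laurentEval_add]
    exact ⟨(polyFun J V).add_mem (ihF S).1 (ihG S).1, by rw [(ihF S).2, (ihG S).2]⟩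

theorem nested_affProd_single (h : ProductsLocallyFinite prodl) (nu mu : Fin m → ℂ) (S : J → ℤ)
    (a : J → V) :
    g.nested (affProd h) nu mu (fun j => Finsupp.single (S j) (a j))
      = laurentEval S fun γ => g.nested prodl (fun t => nu t + fiberSum g.owner γ t.castSucc)
        (fun t => mu t + γ (g.inner t.castSucc)) a := by
  rw [nested, pEval_affProd_single h mu (fun k => S (g.inner k)) fun k => a (g.inner k)]
  exact (g.pEval_update_laurentEval h nu a
    (pEval_add_coord_mem_polyFun h mu Fin.castSucc fun k => a (g.inner k)) S).2

open Sum

/-- The iterated brackets in the left hand side of the Filippov identity. -/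
def left (i : Fin (m + 1)) : Grafting m (Fin (m + 1) ⊕ Fin m) where
  slot := Fin.last m
  outer := Fin.snoc (α := fun _ => Fin (m + 1) ⊕ Fin m) (fun t => inl (i.succAbove t)) (inl i)
  inner := Fin.cons (inl i) inr
  owner := Sum.elim (i.insertNth (α := fun _ => Fin (m + 1)) (Fin.last m) Fin.castSucc)
    fun _ => Fin.last m
  inner_injective := Fin.cons_injective_iff.2 ⟨by simp, inr_injective⟩
  owner_inner k := by
    induction k using Fin.cases <;> simp
  owner_outer k hk := by
    induction k using Fin.lastCases with
    | last => exact absurd rfl hk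
    | cast k => simp
  exists_inner j hj := by
    rcases j with j | j
    · induction j using Fin.succAboveCases i with
      | x => exact ⟨0, by simp⟩
      | p j => simp at hj
    · exact ⟨j.succ, by simp⟩
  outer_owner j hj := by
    rcases j with j | j
    · induction j using Fin.succAboveCases i with
      | x => simp at hj
      | p j => simp
    · simp at hj

/-- The iterated bracket in the right hand side of the Filippov identity. -/
def right (m : ℕ) : Grafting m (Fin (m + 1) ⊕ Fin m) where
  slot := 0
  outer := Fin.cons (inl 0) inr
  inner := inl
  owner := Sum.elim (fun _ => 0) Fin.succ
  inner_injective := inl_injective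
  owner_inner k := rfl
  owner_outer k hk := by
    induction k using Fin.cases with
    | zero => exact absurd rfl hk
    | succ k => simp
  exists_inner j hj := by
    rcases j with j | j
    · exact ⟨j, rfl⟩
    · exact absurd hj (Fin.succ_ne_zero j)
  outer_owner j hj := by
    rcases j with j | j
    · exact absurd rfl hj
    · simp

theorem left_nested (i : Fin (m + 1)) (nu mu : Fin m → ℂ) (a : Fin (m + 1) → V) (b : Fin m → V) :
    (left i).nested prodl nu mu (Sum.elim a b)
      = pEval prodl nu (Fin.snoc (α := fun _ => V) (fun t => a (i.succAbove t))
        (pEval prodl mu (Fin.cons (a i) b))) := by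
  have hi : (fun k => Sum.elim a b ((left i).inner k)) = Fin.cons (a i) b := by
    funext k
    induction k using Fin.cases <;> simp [left]
  rw [nested, hi]
  congr 1
  funext k
  induction k using Fin.lastCases <;> simp [left, Fin.castSucc_ne_last]

theorem right_nested (nu mu : Fin m → ℂ) (a : Fin (m + 1) → V) (b : Fin m → V) :
    (right m).nested prodl nu mu (Sum.elim a b)
      = pEval prodl nu (Fin.cons (pEval prodl mu a) b) := by
  rw [nested]
  congr 1
  funext k
  induction k using Fin.cases <;> simp [right]

end Grafting

end Grafting

section Axioms

variable {m : ℕ} [NeZero m] {V : Type*} [AddCommGroup V] [Module ℂ V]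

theorem NLieConfAlg.productsLocallyFinite (A : NLieConfAlg m V) : ProductsLocallyFinite A.prodl :=
  A.locFin

theorem pEval_affProd_update_laurentD (A : NLieConfAlg m V) (lam : Fin m → ℂ)
    (s : Fin (m + 1) → ℤ) (a : Fin (m + 1) → V) (i : Fin (m + 1)) :
    pEval (affProd A.productsLocallyFinite) lam
      (Function.update (fun i => Finsupp.single (s i) (a i)) i
        (laurentD A.D (Finsupp.single (s i) (a i))))
      = laurentEval s fun α => pEval A.prodl (fun t => lam t + α t.castSucc)
          (Function.update a i (A.D (a i)))
        + α i • pEval A.prodl (fun t => lam t + α t.castSucc) a := by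
  obtain ⟨f, hf⟩ :=
    exists_multilinearMap_eq_pEval (affProd_locallyFinite A.productsLocallyFinite) lam
  have hs : Function.update s i (s i - 1) = s - Pi.single i 1 := by
    funext j
    by_cases hj : j = i
    · subst hj; simp
    · simp [hj]
  rw [← hf, laurentD_single, MultilinearMap.map_update_add, MultilinearMap.map_update_smul,
    update_single, update_single, Function.update_eq_self, Function.update_eq_self, hs, hf, hf,
    pEval_affProd_single, pEval_affProd_single, laurentEval_add, laurentEval_coord]
  exact pEval_add_coord_mem_polyFun A.productsLocallyFinite lam Fin.castSucc a

theorem affProd_sesq (A : NLieConfAlg m V) (lam : Fin m → ℂ) (x : Fin (m + 1) → (ℤ →₀ V))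
    (i : Fin m) :
    pEval (affProd A.productsLocallyFinite) lam
      (Function.update x i.castSucc (laurentD A.D (x i.castSucc)))
      = -(lam i) • pEval (affProd A.productsLocallyFinite) lam x := by
  obtain ⟨f, hf⟩ :=
    exists_multilinearMap_eq_pEval (affProd_locallyFinite A.productsLocallyFinite) lam
  rw [← hf, ← hf]
  refine (f.multiadditive.comp_update (laurentD A.D) i.castSucc).ext
    (f.multiadditive.smul (-(lam i))) (fun s a => ?_) x
  rw [hf, hf, pEval_affProd_update_laurentD, pEval_affProd_single, ← laurentEval_smul]
  congr 1
  funext α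
  rw [A.sesq, ← add_smul]
  congr 1
  ring

theorem affProd_sesqLast (A : NLieConfAlg m V) (lam : Fin m → ℂ) (x : Fin (m + 1) → (ℤ →₀ V)) :
    pEval (affProd A.productsLocallyFinite) lam
      (Function.update x (Fin.last m) (laurentD A.D (x (Fin.last m))))
      = laurentD A.D (pEval (affProd A.productsLocallyFinite) lam x)
        + (∑ s, lam s) • pEval (affProd A.productsLocallyFinite) lam x := by
  obtain ⟨f, hf⟩ :=
    exists_multilinearMap_eq_pEval (affProd_locallyFinite A.productsLocallyFinite) lam
  rw [← hf, ← hf]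
  refine (f.multiadditive.comp_update (laurentD A.D) (Fin.last m)).ext
    ((f.multiadditive.map (laurentD A.D)).add (f.multiadditive.smul _)) (fun s a => ?_) x
  rw [hf, hf, pEval_affProd_update_laurentD, pEval_affProd_single, laurentD_laurentEval,
    ← laurentEval_smul, ← laurentEval_add]
  · congr 1
    funext α
    rw [A.sesqLast, Fin.sum_univ_castSucc, sum_add_distrib]
    module
  · exact pEval_add_coord_mem_polyFun A.productsLocallyFinite lam Fin.castSucc a

theorem affProd_skew (A : NLieConfAlg m V) (lam : Fin m → ℂ) (x : Fin (m + 1) → (ℤ →₀ V))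
    {i j : Fin m} (hij : i ≠ j) :
    pEval (affProd A.productsLocallyFinite) (fun t => lam (Equiv.swap i j t))
        (fun t => x (Equiv.swap i.castSucc j.castSucc t))
      = - pEval (affProd A.productsLocallyFinite) lam x := by
  obtain ⟨f, hf⟩ :=
    exists_multilinearMap_eq_pEval (affProd_locallyFinite A.productsLocallyFinite) lam
  obtain ⟨f', hf'⟩ :=
    exists_multilinearMap_eq_pEval (affProd_locallyFinite A.productsLocallyFinite)
      (fun t => lam (Equiv.swap i j t))
  rw [← hf, ← hf']
  refine (f'.multiadditive.comp_equiv (Equiv.swap i.castSucc j.castSucc)).ext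
    f.multiadditive.neg (fun s a => ?_) x
  rw [hf, hf', pEval_affProd_single, pEval_affProd_single, laurentEval_comp_equiv,
    ← laurentEval_neg]
  · congr 1
    funext α
    rw [← A.skew _ _ i j hij]
    congr 1
    funext t
    dsimp only
    rw [(Fin.castSucc_injective m).swap_apply]
  · exact pEval_add_coord_mem_polyFun A.productsLocallyFinite _ Fin.castSucc _

theorem affProd_skewLast (A : NLieConfAlg m V) (lam : Fin m → ℂ) (x : Fin (m + 1) → (ℤ →₀ V)) :
    pEval (affProd A.productsLocallyFinite) lam x
      = - pEvalOp (laurentD A.D) (affProd A.productsLocallyFinite) lam (∑ s, lam s)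
        (fun t => x (Equiv.swap (Fin.castSucc (lastIdx m)) (Fin.last m) t)) := by
  obtain ⟨f, hf⟩ :=
    exists_multilinearMap_eq_pEval (affProd_locallyFinite A.productsLocallyFinite) lam
  rw [← hf, pEvalOp_eq_opEval,
    ← opEvalMultilinear_apply (affProd_locallyFinite A.productsLocallyFinite)]
  refine f.multiadditive.ext (((opEvalMultilinear _ _ _).multiadditive.comp_equiv
    (Equiv.swap (Fin.castSucc (lastIdx m)) (Fin.last m))).neg) (fun s a => ?_) x
  rw [hf, opEvalMultilinear_apply, pEval_affProd_single]
  rw [opEval_affProd_single A.D A.productsLocallyFinite _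
    (fun t => s (Equiv.swap (Fin.castSucc (lastIdx m)) (Fin.last m) t))]
  have h : ∀ α : Fin (m + 1) → ℂ, opEval A.D A.prodl (fun i => (Function.update
      (fun i => Polynomial.C (lam i)) (lastIdx m)
        (-(Polynomial.X + Polynomial.C (∑ s, lam s))) i).comp
          (Polynomial.X + Polynomial.C (∑ i, α i)) + Polynomial.C (α i.castSucc))
      (fun t => a (Equiv.swap (Fin.castSucc (lastIdx m)) (Fin.last m) t))
      = - pEval A.prodl (fun i => lam i
        + α (Equiv.swap (Fin.castSucc (lastIdx m)) (Fin.last m) i.castSucc)) a := by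
    intro α
    have hne : ∀ i, i ≠ lastIdx m → Equiv.swap (Fin.castSucc (lastIdx m)) (Fin.last m) i.castSucc
        = i.castSucc := fun i hi => Equiv.swap_apply_of_ne_of_ne
      (fun h => hi (Fin.castSucc_injective m h)) (Fin.castSucc_ne_last i)
    have hsum : ∑ i : Fin m, α (Equiv.swap (Fin.castSucc (lastIdx m)) (Fin.last m) i.castSucc)
        = ∑ i, α i - α (Fin.castSucc (lastIdx m)) := by
      rw [← Equiv.sum_comp (Equiv.swap (Fin.castSucc (lastIdx m)) (Fin.last m)) α,
        Fin.sum_univ_castSucc, Equiv.swap_apply_right]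
      ring
    rw [A.skewLast, neg_neg, pEvalOp_eq_opEval, sum_add_distrib, hsum]
    congr 1
    funext i
    by_cases hi : i = lastIdx m
    · subst hi
      simp only [Function.update_self, Polynomial.neg_comp, Polynomial.add_comp, Polynomial.X_comp,
        Polynomial.C_comp, map_add, map_sub]
      ring
    · simp only [Function.update_of_ne hi, Polynomial.C_comp, hne i hi, map_add]
  simp only [h]
  rw [laurentEval_neg, neg_neg, laurentEval_comp_equiv]
  · simp only [Equiv.swap_apply_self]
  · exact pEval_add_coord_mem_polyFun A.productsLocallyFinite lam
      (fun i => Equiv.swap (Fin.castSucc (lastIdx m)) (Fin.last m) i.castSucc) a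

theorem update_zero_add_cons {J : Type*} (mus : Fin m → ℂ) (c : ℂ) (γ : J → ℂ) (j j' : J)
    (q : Fin m → J) :
    (fun t => Function.update mus 0 c t + γ (Fin.cons (α := fun _ => J) j q t.castSucc))
      = Function.update (fun t => mus t + γ (Fin.cons (α := fun _ => J) j' q t.castSucc)) 0
        (c + γ j) := by
  funext t
  by_cases ht : t = 0
  · subst ht
    simp
  · obtain ⟨k, hk⟩ := Fin.exists_succ_eq.2
      (fun h => ht (Fin.castSucc_injective m (h.trans Fin.castSucc_zero'.symm)) :
        t.castSucc ≠ 0)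
    simp [ht, ← hk]

theorem affProd_filippov (A : NLieConfAlg m V) (lam : Fin (m + 1) → ℂ) (mus : Fin m → ℂ)
    (a : Fin (m + 1) → (ℤ →₀ V)) (b : Fin m → (ℤ →₀ V)) :
    ∑ i : Fin (m + 1), ((-1 : ℂ) ^ (m - (i : ℕ))) •
        pEval (affProd A.productsLocallyFinite) (fun s => lam (i.succAbove s))
          (Fin.snoc (fun s => a (i.succAbove s))
            (pEval (affProd A.productsLocallyFinite) (Function.update mus 0 (lam i))
              (Fin.cons (a i) b)))
      = pEval (affProd A.productsLocallyFinite) (Function.update mus 0 (∑ i, lam i))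
          (Fin.cons (pEval (affProd A.productsLocallyFinite) (fun s => lam s.castSucc) a) b) := by
  have hB := affProd_locallyFinite A.productsLocallyFinite
  rw [← Grafting.right_nested]
  simp only [← Grafting.left_nested]
  refine Multiadditive.ext (.sum univ fun i =>
    ((Grafting.left i).nested_multiadditive hB _ _).smul ((-1 : ℂ) ^ (m - (i : ℕ))))
    ((Grafting.right m).nested_multiadditive hB _ _) (fun s a => ?_) (Sum.elim a b)
  obtain ⟨a, b, rfl⟩ : ∃ (a' : Fin (m + 1) → V) (b' : Fin m → V), a = Sum.elim a' b' :=
    ⟨_, _, (Sum.elim_comp_inl_inr a).symm⟩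
  simp only [Grafting.nested_affProd_single, ← laurentEval_smul]
  rw [← laurentEval_sum]
  congr 1
  funext γ
  simp only [Grafting.left_nested, Grafting.right_nested]
  refine Eq.trans (sum_congr rfl fun i _ => ?_) ((A.filippov (fun i => lam i + γ (Sum.inl i))
    (fun t => mus t + γ (Fin.cons (α := fun _ => Fin (m + 1) ⊕ Fin m)
      (Sum.inl 0) Sum.inr t.castSucc)) a b).trans ?_)
  · congr 2
    · funext t
      rw [(Grafting.left i).fiberSum_owner_of_ne γ (Fin.castSucc_ne_last t)]
      simp [Grafting.left]
    · congr 2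
      exact update_zero_add_cons mus (lam i) γ (Sum.inl i) (Sum.inl 0) Sum.inr
  · congr 1
    funext t
    by_cases ht : t = 0
    · subst ht
      have h := (Grafting.right m).fiberSum_owner_slot γ
      rw [Function.update_self, Function.update_self, sum_add_distrib, Fin.castSucc_zero']
      exact congrArg _ h.symm
    · have h : t.castSucc ≠ 0 := fun h =>
        ht (Fin.castSucc_injective m (h.trans Fin.castSucc_zero'.symm))
      rw [Function.update_of_ne ht, Function.update_of_ne ht,
        (Grafting.right m).fiberSum_owner_of_ne γ h]
      rfl

end Axioms

/-- for an `n`-Lie conformal algebra `R` (`n = m + 1`), the module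
`R̃ = R[t, t⁻¹]` (modelled as `ℤ →₀ R`, with `a ⊗ t^s ↦ single s a`) equipped with
`∂̃ = ∂ ⊗ 1 + 1 ⊗ ∂ₜ` and the products
`(a¹⊗f₁)_{(k₁)}⋯(a^n⊗f_n) = Σ_j (a¹_{(k₁+j₁)}⋯a^n) ⊗ (∂ₜ^{(j₁)}f₁)⋯(∂ₜ^{(j_{n-1})}f_{n-1})f_n`
is an `n`-Lie conformal algebra. -/
theorem stmt10 {m : ℕ} [NeZero m] {R : Type*} [AddCommGroup R] [Module ℂ R]
    (A : NLieConfAlg m R) :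
    ∃ B : NLieConfAlg m (ℤ →₀ R),
      B.D = Finsupp.lsum ℂ (fun s : ℤ =>
        Finsupp.lsingle s ∘ₗ (A.D : R →ₗ[ℂ] R) + ((s : ℂ)) • Finsupp.lsingle (s - 1)) ∧
      ∀ (s : Fin (m + 1) → ℤ) (a : Fin (m + 1) → R) (k : Fin m → ℕ),
        B.prodl k (fun i => Finsupp.single (s i) (a i))
          = ∑ᶠ jv : Fin m → ℕ,
              (∏ i : Fin m, genChoose (s i.castSucc) (jv i)) •
                Finsupp.single ((∑ i, s i) - ∑ i : Fin m, (jv i : ℤ))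
                  (A.prodl (fun i => k i + jv i) a) := by
  exact ⟨{ D := laurentD A.D
           prodl := affProd A.productsLocallyFinite
           locFin := affProd_locallyFinite A.productsLocallyFinite
           sesq := affProd_sesq A
           sesqLast := affProd_sesqLast A
           skew := fun lam x _ _ hij => affProd_skew A lam x hij
           skewLast := affProd_skewLast A
           filippov := affProd_filippov A }, rfl,
    fun s a k => affProd_single A.productsLocallyFinite k s a⟩
end
end

section
/- Let R be an n-Lie conformal algebra that is free as a ℂ[∂]-module, say R ≅ ℂ[∂] ⊗ V for a ℂ-vector space V. Then for every p ≥ 1 there is a ℂ-linear isomorphism ℒie_p R ≅ V[t₁^{±1},…,t_p^{±1}]; that is, R[t₁^{±1},…,t_p^{±1}] = V[t₁^{±1},…,t_p^{±1}] ⊕ ∂̃_p R[t₁^{±1},…,t_p^{±1}]. -/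
noncomputable section

/-- The operator `∂̃_p = ∂ + ∂_{t₁} + ⋯ + ∂_{t_p}` on
`(ℂ[∂] ⊗ V)[t₁^{±1},…,t_p^{±1}]`, modelled as `((Fin p → ℤ) × ℕ) →₀ V` where an index
`(m, k)` records the Laurent monomial `t₁^{m₁}⋯t_p^{m_p}` and the power `∂^k`:
`v t^m ∂^k ↦ v t^m ∂^{k+1} + Σᵢ mᵢ v t^{m−eᵢ} ∂^k`. -/
def DtildeFree (V : Type*) [AddCommGroup V] [Module ℂ V] (p : ℕ) :
    (((Fin p → ℤ) × ℕ) →₀ V) →ₗ[ℂ] (((Fin p → ℤ) × ℕ) →₀ V) :=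
  Finsupp.lsum ℂ (fun q : (Fin p → ℤ) × ℕ =>
    Finsupp.lsingle (q.1, q.2 + 1) +
      ∑ i : Fin p, ((q.1 i : ℂ)) • Finsupp.lsingle (q.1 - Pi.single i 1, q.2))

theorem DtildeFree_single {V : Type*} [AddCommGroup V] [Module ℂ V] {p : ℕ}
    (m : Fin p → ℤ) (k : ℕ) (v : V) :
    DtildeFree V p (Finsupp.single (m, k) v) = Finsupp.single (m, k + 1) v +
      ∑ i : Fin p, (m i : ℂ) • Finsupp.single (m - Pi.single i 1, k) v := by
  simp [DtildeFree, LinearMap.sum_apply]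

theorem DtildeFree_apply_succ {V : Type*} [AddCommGroup V] [Module ℂ V] {p : ℕ}
    (y : ((Fin p → ℤ) × ℕ) →₀ V) (m : Fin p → ℤ) (k : ℕ) :
    DtildeFree V p y (m, k + 1) = y (m, k) +
      ∑ i : Fin p, ((m i + 1 : ℤ) : ℂ) • y (m + Pi.single i 1, k + 1) := by
  induction y using Finsupp.induction_linear with
  | zero => simp
  | add f g hf hg =>
    simp only [map_add, Finsupp.add_apply, hf, hg, smul_add, Finset.sum_add_distrib]
    abel
  | single q v =>
    obtain ⟨m', k'⟩ := q
    rw [DtildeFree_single, Finsupp.add_apply, Finsupp.finsetSum_apply]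
    congr 1
    · simp [Finsupp.single_apply]
    · refine Finset.sum_congr rfl fun i _ => ?_
      by_cases h : m' = m + Pi.single i 1
      · subst h
        simp [Finsupp.single_apply]
      · have h' : m' - Pi.single i 1 ≠ m := fun e => h (sub_eq_iff_eq_add.mp e)
        simp [h, h']

theorem eq_zero_of_DtildeFree_apply_succ_eq_zero {V : Type*} [AddCommGroup V] [Module ℂ V]
    {p : ℕ} (y : ((Fin p → ℤ) × ℕ) →₀ V)
    (hy : ∀ m k, DtildeFree V p y (m, k + 1) = 0) : y = 0 := by
  have descend : ∀ n, (∀ k, n ≤ k → ∀ m, y (m, k) = 0) → y = 0 := by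
    intro n
    induction n with
    | zero => exact fun h => Finsupp.ext fun q => h q.2 (Nat.zero_le _) q.1
    | succ n ih =>
      refine fun h => ih fun k hk m => ?_
      have hmk := hy m k
      rw [DtildeFree_apply_succ] at hmk
      simpa [h (k + 1) (by lia)] using hmk
  refine descend (y.support.sup Prod.snd + 1) fun k hk m => ?_
  by_contra hne
  have : k ≤ y.support.sup Prod.snd :=
    Finset.le_sup (f := Prod.snd) (Finsupp.mem_support_iff.mpr hne)
  lia

theorem single_mem_supported_sup_range_DtildeFree {V : Type*} [AddCommGroup V] [Module ℂ V]
    {p : ℕ} (k : ℕ) (m : Fin p → ℤ) (v : V) :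
    Finsupp.single (m, k) v ∈
      Finsupp.supported V ℂ {q : (Fin p → ℤ) × ℕ | q.2 = 0} ⊔
        LinearMap.range (DtildeFree V p) := by
  induction k generalizing m with
  | zero => exact Submodule.mem_sup_left (Finsupp.single_mem_supported ℂ v rfl)
  | succ k ih =>
    rw [eq_sub_of_add_eq (DtildeFree_single m k v).symm]
    exact sub_mem (Submodule.mem_sup_right (LinearMap.mem_range_self _ _))
      (sum_mem fun i _ => Submodule.smul_mem _ _ (ih _))

/-- if `R = ℂ[∂] ⊗ V` is a free `ℂ[∂]`-module, then for every `p ≥ 1`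
`R[t₁^{±1},…,t_p^{±1}] = V[t₁^{±1},…,t_p^{±1}] ⊕ ∂̃_p R[t₁^{±1},…,t_p^{±1}]`;
equivalently `ℒie_p R ≅ V[t₁^{±1},…,t_p^{±1}]` as ℂ-vector spaces.  Here
`V[t₁^{±1},…,t_p^{±1}]` is the subspace of elements supported in `∂`-degree `0`. -/
theorem stmt12 (V : Type*) [AddCommGroup V] [Module ℂ V] (p : ℕ) (hp : 1 ≤ p) :
    IsCompl
      (Finsupp.supported V ℂ {q : (Fin p → ℤ) × ℕ | q.2 = 0})
      (LinearMap.range (DtildeFree V p)) := by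
  constructor
  · rw [Submodule.disjoint_def]
    rintro _ hx ⟨y, rfl⟩
    rw [eq_zero_of_DtildeFree_apply_succ_eq_zero y fun m k => ?_, map_zero]
    rw [Finsupp.mem_supported'] at hx
    exact hx _ (Nat.succ_ne_zero k)
  · rw [codisjoint_iff, eq_top_iff]
    intro x _
    induction x using Finsupp.induction_linear with
    | zero => exact zero_mem _
    | add f g hf hg => exact add_mem (hf trivial) (hg trivial)
    | single q v => exact single_mem_supported_sup_range_DtildeFree q.2 q.1 v
end
end
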